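/- arXiv:1810.03142 — 6 statements merged into one kernel-verified Lean document; each statement's English description precedes it below -/
import Mathlib

section
/- Let p be an odd prime with p not congruent to 1 modulo 8, and let a, b ∈ F_p satisfy ab = −3. Then the polynomial f(x) = x^p + a·x^2 + b ∈ F_p[x] is not stable over F_p. -/
open Polynomial

/-- The discriminant of an odd-degree extension of `ZMod p` is a square. -/
theorem isSquare_discr_of_odd_finrank {p : ℕ} [Fact p.Prime] {L ι : Type*}
    [Field L] [Algebra (ZMod p) L] [FiniteDimensional (ZMod p) L] [Fintype ι] [DecidableEq ι]
    (hodd : Odd (Module.finrank (ZMod p) L)) (b : Module.Basis ι (ZMod p) L) :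
    IsSquare (Algebra.discr (ZMod p) b) := by
  classical
  have : Finite L := Module.finite_of_finite (ZMod p)
  let E := AlgebraicClosure L
  have : CharP E p := charP_of_injective_algebraMap (algebraMap (ZMod p) E).injective p
  have hcard : Fintype.card ι = Fintype.card (L →ₐ[ZMod p] E) := by
    rw [AlgHom.card, Module.finrank_eq_card_basis b]
  let e : ι ≃ (L →ₐ[ZMod p] E) := Fintype.equivOfCardEq hcard
  let F : L ≃ₐ[ZMod p] L := FiniteField.frobeniusAlgEquivOfAlgebraic (ZMod p) L
  let τ : Equiv.Perm (L →ₐ[ZMod p] E) :=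
    { toFun := fun φ => φ.comp (F : L →ₐ[ZMod p] L)
      invFun := fun φ => φ.comp (F.symm : L →ₐ[ZMod p] L)
      left_inv := fun φ => by ext x; simp
      right_inv := fun φ => by ext x; simp }
  have hτ (n : ℕ) (φ : L →ₐ[ZMod p] E) : (τ ^ n) φ =
      φ.comp ((F ^ n : L ≃ₐ[ZMod p] L) : L →ₐ[ZMod p] L) := by
    induction n with
    | zero => ext x; simp
    | succ n ih =>
      rw [pow_succ', Equiv.Perm.mul_apply, ih]
      ext x
      simp [τ, pow_succ, AlgEquiv.mul_apply]
  have hτ1 : τ ^ Module.finrank (ZMod p) L = 1 := by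
    ext φ x
    rw [hτ, ← FiniteField.orderOf_frobeniusAlgEquivOfAlgebraic (ZMod p) L, pow_orderOf_eq_one]
    simp
  let σ : Equiv.Perm ι := (e.trans τ).trans e.symm
  have hsign : Equiv.Perm.sign σ = 1 := by
    have h1 : Equiv.Perm.sign σ = Equiv.Perm.sign τ := Equiv.Perm.sign_trans_trans_symm τ e
    have h2 : Equiv.Perm.sign τ ^ Module.finrank (ZMod p) L = 1 := by
      rw [← map_pow, hτ1, map_one]
    rw [h1]
    rcases Int.units_eq_one_or (Equiv.Perm.sign τ) with h | h
    · exact h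
    · rw [h, hodd.neg_one_pow] at h2
      exact absurd h2 (by decide)
  set M := Algebra.embeddingsMatrixReindex (ZMod p) E b e with hM
  have hM' (i j : ι) : M i j = e j (b i) := rfl
  have hD : algebraMap (ZMod p) E (Algebra.discr (ZMod p) b) = M.det ^ 2 :=
    Algebra.discr_eq_det_embeddingsMatrixReindex_pow_two (ZMod p) E b e
  have hfrob : M.det ^ p = M.det := by
    have h1 : M.map (frobenius E p) = M.submatrix id σ := by
      ext i j
      simp [hM', σ, τ, frobenius_def, F]
    have h2 := RingHom.map_det (frobenius E p) M
    rw [RingHom.mapMatrix_apply, h1, Matrix.det_permute', hsign, frobenius_def] at h2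
    simpa using h2
  have hD0 : Algebra.discr (ZMod p) b ≠ 0 := Algebra.discr_not_zero_of_basis _ b
  rcases (Fact.out : p.Prime).eq_two_or_odd with rfl | hp
  · exact FiniteField.isSquare_of_char_two (ringChar.eq_iff.mpr inferInstance) _
  · rw [ZMod.euler_criterion p hD0]
    apply (algebraMap (ZMod p) E).injective
    have hdet : M.det ≠ 0 := by
      intro h
      rw [h, zero_pow two_ne_zero, map_eq_zero] at hD
      exact hD0 hD
    rw [map_pow, hD, ← pow_mul, map_one]
    apply mul_right_cancel₀ hdet
    rw [← pow_succ, one_mul, show 2 * (p / 2) + 1 = p by omega, hfrob]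

/-- If `x` in an odd-degree extension is a root of a monic irreducible `h`, then the norm of `x`
agrees with `-h(0)` up to a square. -/
theorem exists_norm_eq_neg_coeff_zero_mul_sq {K L : Type*} [Field K] [Field L] [Algebra K L]
    [FiniteDimensional K L] [Algebra.IsSeparable K L] (hodd : Odd (Module.finrank K L))
    {h : K[X]} (hm : h.Monic) (hi : Irreducible h) {x : L} (hx : aeval x h = 0) :
    ∃ s : K, Algebra.norm K x = -h.coeff 0 * s ^ 2 := by
  have hmin : h = minpoly K x := minpoly.eq_of_irreducible_of_monic hi hx hm
  have hint : IsIntegral K x := .of_finite K x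
  have hmul := Module.finrank_mul_finrank K (IntermediateField.adjoin K {x}) L
  rw [← hmul, Nat.odd_mul] at hodd
  have hgen : Algebra.norm K (IntermediateField.AdjoinSimple.gen K x) = -h.coeff 0 := by
    have h1 := Algebra.PowerBasis.norm_gen_eq_coeff_zero_minpoly
      (IntermediateField.adjoin.powerBasis hint)
    rw [IntermediateField.adjoin.powerBasis_gen, IntermediateField.minpoly_gen, ← hmin,
      ← PowerBasis.finrank, hodd.1.neg_one_pow] at h1
    rw [h1]; ring
  obtain ⟨k, hk⟩ := hodd.2
  refine ⟨(-h.coeff 0) ^ k, ?_⟩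
  rw [Algebra.norm_eq_norm_adjoin, hgen, hk]
  ring

/-- For an irreducible polynomial over `ZMod p` of degree `1` modulo `4`, the norm of its derivative
at a root is a nonzero square. -/
theorem exists_norm_aeval_root_derivative_eq_sq {p : ℕ} [Fact p.Prime] {g : (ZMod p)[X]}
    [Fact (Irreducible g)] (hm : g.Monic) (hdeg : g.natDegree % 4 = 1) :
    ∃ t : ZMod p, t ≠ 0 ∧
      Algebra.norm (ZMod p) (aeval (AdjoinRoot.root g) (derivative g)) = t ^ 2 := by
  have hg0 := hm.ne_zero
  let pb := AdjoinRoot.powerBasis hg0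
  have : FiniteDimensional (ZMod p) (AdjoinRoot g) := pb.finite
  have hfin : Module.finrank (ZMod p) (AdjoinRoot g) = g.natDegree := by
    rw [pb.finrank]; rfl
  have hsq := isSquare_discr_of_odd_finrank (p := p)
    (by rw [hfin, Nat.odd_iff]; omega) pb.basis
  have hne : Algebra.discr (ZMod p) pb.basis ≠ 0 := Algebra.discr_not_zero_of_basis _ _
  obtain ⟨t, ht⟩ := hsq
  have hdisc := Algebra.discr_powerBasis_eq_norm (ZMod p) pb
  have heven : Even (g.natDegree * (g.natDegree - 1) / 2) := by
    obtain ⟨k, hk⟩ : ∃ k, g.natDegree = 4 * k + 1 := ⟨g.natDegree / 4, by omega⟩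
    rw [hk, Nat.add_sub_cancel, show (4 * k + 1) * (4 * k) = 2 * (2 * (k * (4 * k + 1))) by ring,
      Nat.mul_div_cancel_left _ two_pos]
    exact even_two_mul _
  rw [hfin, heven.neg_one_pow, one_mul, AdjoinRoot.minpoly_powerBasis_gen_of_monic hm,
    AdjoinRoot.powerBasis_gen] at hdisc
  refine ⟨t, ?_, ?_⟩
  · rintro rfl
    exact hne (by simpa using ht)
  · rw [← hdisc, ht, sq]

theorem trinomial_xp_ax2_b_not_stable
    (p : ℕ) (hp : p.Prime) (hodd : p ≠ 2) (hmod : p % 8 ≠ 1)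
    (a b : ZMod p) (hab : a * b = -3)
    (f : Polynomial (ZMod p))
    (hf : f = X ^ p + C a * X ^ 2 + C b) :
    ¬ (∀ k : ℕ, 1 ≤ k → Irreducible ((fun q => f.comp q)^[k] (X : Polynomial (ZMod p)))) := by
  intro hstable
  have : Fact p.Prime := ⟨hp⟩
  have hp2 : p % 2 = 1 := (hp.eq_two_or_odd).resolve_left hodd
  have hp3 : 2 < p := lt_of_le_of_ne hp.two_le hodd.symm
  have hi1 : Irreducible f := by simpa using hstable 1 le_rfl
  have hi2 : Irreducible (f.comp f) := by simpa using hstable 2 (by norm_num)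
  have hi3 : Irreducible (f.comp (f.comp f)) := by simpa using hstable 3 (by norm_num)
  have hlt : (C a * X ^ 2 + C b : (ZMod p)[X]).degree < (p : ℕ) :=
    lt_of_le_of_lt (b := ((2 : ℕ) : WithBot ℕ)) (by compute_degree!) (by exact_mod_cast hp3)
  have hm1 : f.Monic := by
    rw [hf, add_assoc]; exact monic_X_pow_add hlt
  have hd1 : f.natDegree = p := by
    rw [hf, add_assoc]
    rw [natDegree_add_eq_left_of_degree_lt (by rwa [degree_X_pow]), natDegree_X_pow]
  have hm2 : (f.comp f).Monic := hm1.comp hm1 (by omega)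
  have hd2 : (f.comp f).natDegree = p * p := by rw [natDegree_comp, hd1]
  have hm3 : (f.comp (f.comp f)).Monic := hm1.comp hm2 (by rw [hd2]; positivity)
  have hd3 : (f.comp (f.comp f)).natDegree = p * (p * p) := by rw [natDegree_comp, hd1, hd2]
  have hder : derivative f = C (2 * a) * X := by
    rw [hf]; simp [C_mul, derivative_X_pow, C_ofNat]; ring
  have he (c : ZMod p) : f.eval c = c + a * c ^ 2 + b := by
    rw [hf]; simp
  have he0 : f.coeff 0 = b := by rw [coeff_zero_eq_eval_zero, he]; ring
  have he1 : (f.comp f).coeff 0 = -b := by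
    rw [coeff_zero_eq_eval_zero, eval_comp, he, he]; linear_combination b * hab
  have he2 : (f.comp (f.comp f)).coeff 0 = -3 * b := by
    rw [coeff_zero_eq_eval_zero, eval_comp, ← coeff_zero_eq_eval_zero (f.comp f), he1, he]
    linear_combination b * hab
  by_cases h4 : p % 4 = 3
  · have : Fact (Irreducible (f.comp f)) := ⟨hi2⟩
    have hdeg : (f.comp f).natDegree % 4 = 1 := by
      rw [hd2, Nat.mul_mod, h4]
    obtain ⟨t, ht0, ht⟩ := exists_norm_aeval_root_derivative_eq_sq hm2 hdeg
    have : FiniteDimensional (ZMod p) (AdjoinRoot (f.comp f)) := hm2.finite_adjoinRoot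
    set α := AdjoinRoot.root (f.comp f) with hα
    have hfin : Odd (Module.finrank (ZMod p) (AdjoinRoot (f.comp f))) := by
      rw [(AdjoinRoot.powerBasis hm2.ne_zero).finrank, AdjoinRoot.powerBasis_dim, Nat.odd_iff]
      omega
    have hα0 : aeval α (f.comp f) = 0 := by simp [hα, AdjoinRoot.aeval_eq]
    obtain ⟨s, hs⟩ := exists_norm_eq_neg_coeff_zero_mul_sq hfin hm2 hi2 hα0
    obtain ⟨r, hr⟩ := exists_norm_eq_neg_coeff_zero_mul_sq hfin hm1 hi1
      (x := aeval α f) (by rw [← aeval_comp, hα0])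
    have hd : aeval α (derivative (f.comp f)) =
        algebraMap (ZMod p) (AdjoinRoot (f.comp f)) ((2 * a) ^ 2) * α * aeval α f := by
      rw [derivative_comp, hder]; simp; ring
    rw [hd, map_mul, map_mul, hs, hr, he0, he1, Algebra.norm_algebraMap] at ht
    set m := (2 * a) ^ Module.finrank (ZMod p) (AdjoinRoot (f.comp f)) with hm
    have hw : -1 * (b * s * r * m) ^ 2 = t ^ 2 := by
      rw [← ht, pow_right_comm, ← hm]; ring
    have hw0 : b * s * r * m ≠ 0 := by
      intro h
      rw [h] at hw
      exact pow_ne_zero 2 ht0 (by simpa using hw.symm)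
    refine ZMod.exists_sq_eq_neg_one_iff.mp ⟨t / (b * s * r * m), ?_⟩ h4
    rw [div_mul_div_comm, ← sq, ← sq, ← hw, mul_div_cancel_right₀ _ (pow_ne_zero 2 hw0)]
  · have : Fact (Irreducible (f.comp (f.comp f))) := ⟨hi3⟩
    have hdeg : (f.comp (f.comp f)).natDegree % 4 = 1 := by
      have h1 : p % 4 = 1 := by omega
      rw [hd3, Nat.mul_mod, Nat.mul_mod p p, h1]
    obtain ⟨t, ht0, ht⟩ := exists_norm_aeval_root_derivative_eq_sq hm3 hdeg
    have : FiniteDimensional (ZMod p) (AdjoinRoot (f.comp (f.comp f))) := hm3.finite_adjoinRoot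
    set α := AdjoinRoot.root (f.comp (f.comp f)) with hα
    have hfin : Odd (Module.finrank (ZMod p) (AdjoinRoot (f.comp (f.comp f)))) := by
      rw [(AdjoinRoot.powerBasis hm3.ne_zero).finrank, AdjoinRoot.powerBasis_dim, Nat.odd_iff]
      omega
    have hα0 : aeval α (f.comp (f.comp f)) = 0 := by simp [hα, AdjoinRoot.aeval_eq]
    obtain ⟨s, hs⟩ := exists_norm_eq_neg_coeff_zero_mul_sq hfin hm3 hi3 hα0
    obtain ⟨r, hr⟩ := exists_norm_eq_neg_coeff_zero_mul_sq hfin hm2 hi2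
      (x := aeval α f) (by rw [← aeval_comp, comp_assoc, hα0])
    obtain ⟨u, hu⟩ := exists_norm_eq_neg_coeff_zero_mul_sq hfin hm1 hi1
      (x := aeval α (f.comp f)) (by rw [← aeval_comp, hα0])
    have hd : aeval α (derivative (f.comp (f.comp f))) =
        algebraMap (ZMod p) (AdjoinRoot (f.comp (f.comp f))) ((2 * a) ^ 3) * α * aeval α f *
          aeval α (f.comp f) := by
      rw [derivative_comp, derivative_comp, hder]; simp; ring
    obtain ⟨k, hk⟩ := hfin
    rw [hd, map_mul, map_mul, map_mul, hs, hr, hu, he0, he1, he2, Algebra.norm_algebraMap,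
      hk] at ht
    set m := ((2 * a) ^ 3) ^ k with hm
    have hw : 2 * (18 * m * s * r * u) ^ 2 = t ^ 2 := by
      have h3 : (a * b) ^ 3 = -27 := by rw [hab]; ring
      rw [← ht, pow_succ ((2 * a) ^ 3), pow_mul', ← hm]
      linear_combination 24 * (m * s * r * u) ^ 2 * h3
    have hw0 : 18 * m * s * r * u ≠ 0 := by
      intro h
      rw [h] at hw
      exact pow_ne_zero 2 ht0 (by simpa using hw.symm)
    have h2 := (ZMod.exists_sq_eq_two_iff hodd).mp ⟨t / (18 * m * s * r * u), by
      rw [div_mul_div_comm, ← sq, ← sq, ← hw, mul_div_cancel_right₀ _ (pow_ne_zero 2 hw0)]⟩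
    omega
end

section
/- Let n ≥ 1, let g(x) ∈ F_2[x], and let s be an integer with 8·deg(g) < s < 2n. Then the polynomial f(x) = x^(2n) + x^s + g(x^8) + 1 ∈ F_2[x] is not stable over F_2. -/
open Polynomial

theorem sum_div_add_sq_add_self {K : Type*} [Field K] [CharP K 2] (a : ℕ → K) {N : ℕ}
    (hN : Even N) (hN0 : 0 < N) (hsq : ∀ i, a (i + 1) = a i ^ 2) (hper : a N = a 0)
    (hne : ∀ i j, i < j → j < N → a i + a j ≠ 0) :
    (∑ j ∈ Finset.range N, ∑ i ∈ Finset.range j, a j / (a i + a j)) ^ 2 +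
      ∑ j ∈ Finset.range N, ∑ i ∈ Finset.range j, a j / (a i + a j) = 1 := by
  have h2 : (2 : K) = 0 := CharTwo.two_eq_zero
  obtain ⟨k, rfl⟩ : ∃ k, N = k + 1 := ⟨N - 1, by omega⟩
  have hk : (k : K) = 1 := by
    obtain ⟨r, hr⟩ := hN
    have h : ((k + 1 : ℕ) : K) = ((r + r : ℕ) : K) := by rw [hr]
    push_cast at h
    linear_combination h + (r - 1 : K) * h2
  have hself (j : ℕ) : (∑ i ∈ Finset.range j, a j / (a i + a j)) ^ 2 =
      ∑ i ∈ Finset.range j, a (j + 1) / (a (i + 1) + a (j + 1)) := by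
    rw [CharTwo.sum_sq]
    refine Finset.sum_congr rfl fun i _ => ?_
    rw [div_pow, CharTwo.add_sq, hsq, hsq]
  have hlast : ∑ i ∈ Finset.range k, a (k + 1) / (a (i + 1) + a (k + 1)) +
      ∑ i ∈ Finset.range k, a (i + 1) / (a 0 + a (i + 1)) = 1 := by
    rw [← Finset.sum_add_distrib, hper, ← hk, ← Finset.card_range k, Finset.cast_card]
    simp only [Finset.card_range]
    refine Finset.sum_congr rfl fun i hi => ?_
    have h0 := hne 0 (i + 1) (by omega) (by have := Finset.mem_range.1 hi; omega)
    rw [add_comm (a (i + 1)) (a 0), ← add_div, div_self h0]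
  rw [CharTwo.sum_sq, Finset.sum_congr rfl fun j _ => hself j, Finset.sum_range_succ,
    Finset.sum_range_succ' (fun j => ∑ i ∈ Finset.range j, a j / (a i + a j))]
  simp only [Finset.range_zero, Finset.sum_empty, add_zero]
  simp_rw [Finset.sum_range_succ' (fun i => a (_ + 1) / (a i + a (_ + 1)))]
  rw [Finset.sum_add_distrib]
  linear_combination hlast + h2 * ∑ j ∈ Finset.range k, ∑ i ∈ Finset.range j,
    a (j + 1) / (a (i + 1) + a (j + 1))

theorem exists_prod_add_sub_prod_sub {O K ι : Type*} [CommRing O] [Field K] (φ : O →+* K)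
    (s : Finset ι) (x y : ι → O) (h2 : φ 2 = 0) (h : ∀ i ∈ s, φ (x i + y i) ≠ 0) :
    ∃ q, ∏ i ∈ s, (x i + y i) - ∏ i ∈ s, (x i - y i) = 2 * q ∧
      φ q = φ (∏ i ∈ s, (x i + y i)) * ∑ i ∈ s, φ (y i) / (φ (x i) + φ (y i)) := by
  classical
  induction s using Finset.induction_on with
  | empty => exact ⟨0, by simp⟩
  | insert i s hi ih =>
    obtain ⟨q, hq, hφ⟩ := ih fun j hj => h j (Finset.mem_insert_of_mem hj)
    have hi' := h i (Finset.mem_insert_self i s)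
    refine ⟨(x i - y i) * q + y i * ∏ j ∈ s, (x j + y j), ?_, ?_⟩
    · rw [Finset.prod_insert hi, Finset.prod_insert hi]
      linear_combination (x i - y i) * hq
    · rw [Finset.prod_insert hi, Finset.sum_insert hi]
      simp only [map_add, map_sub, map_mul] at hi' ⊢
      rw [hφ]
      have h2' : (2 : K) = 0 := by rw [← map_ofNat φ 2]; exact h2
      field_simp
      linear_combination (-φ (y i) * φ (∏ i ∈ s, (x i + y i)) *
        ∑ i ∈ s, φ (y i) / (φ (x i) + φ (y i))) * h2'

theorem prod_Iio_add_isSymmetric (N : ℕ) :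
    (∏ j : Fin N, ∏ i ∈ Finset.Iio j,
      (MvPolynomial.X i + MvPolynomial.X j : MvPolynomial (Fin N) ℤ)).IsSymmetric := by
  intro σ
  let V : MvPolynomial (Fin N) ℤ :=
    ∏ j : Fin N, ∏ i ∈ Finset.Iio j, (MvPolynomial.X i - MvPolynomial.X j)
  have hV : V ≠ 0 := by
    refine Finset.prod_ne_zero_iff.2 fun j _ => Finset.prod_ne_zero_iff.2 fun i hi => ?_
    rw [sub_ne_zero]
    exact fun h => (Finset.mem_Iio.1 hi).ne (MvPolynomial.X_injective h)
  have h1 := σ.prod_Iio_comp_eq_sign_mul_prod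
    (f := fun i j => (MvPolynomial.X i - MvPolynomial.X j : MvPolynomial (Fin N) ℤ))
    fun i j => by ring
  have h2 := σ.prod_Iio_comp_eq_sign_mul_prod
    (f := fun i j => ((MvPolynomial.X i - MvPolynomial.X j) *
      (MvPolynomial.X i + MvPolynomial.X j) : MvPolynomial (Fin N) ℤ))
    fun i j => by ring
  simp only [Finset.prod_mul_distrib] at h2
  rw [h1, mul_assoc] at h2
  have hs : ((σ.sign : ℤ) : MvPolynomial (Fin N) ℤ) ≠ 0 := by
    simp
  simpa [map_prod] using mul_left_cancel₀ hV (mul_left_cancel₀ hs h2)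

theorem aeval_esymm_eq_coeff (R : Type*) {S : Type*} [CommRing R] [CommRing S]
    [Algebra R S] {N : ℕ} (α : Fin N → S) (k : ℕ) :
    MvPolynomial.aeval α (MvPolynomial.esymm (Fin N) R k) =
      if k ≤ N then (-1) ^ k * (∏ i, (X - C (α i))).coeff (N - k) else 0 := by
  split_ifs with hk
  · have hm : ∏ i, (X - C (α i)) = ((Finset.univ.val.map α).map fun t => X - C t).prod := by
      rw [Multiset.map_map]; rfl
    rw [hm, Multiset.prod_X_sub_C_coeff _ (by simp), MvPolynomial.aeval_esymm_eq_multiset_esymm]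
    simp only [Multiset.card_map, Finset.card_val, Finset.card_univ, Fintype.card_fin]
    rw [Nat.sub_sub_self hk, ← mul_assoc, ← mul_pow]
    simp
  · rw [MvPolynomial.esymm, Finset.powersetCard_eq_empty.2 (by simpa using hk)]
    simp

theorem exists_aeval_eq_intCast_of_isSymmetric {N : ℕ} {O : Type*} [CommRing O]
    {p : MvPolynomial (Fin N) ℤ} (hp : p.IsSymmetric) (G : ℤ[X]) (γ : Fin N → O)
    (hG : G.map (Int.castRingHom O) = ∏ i, (X - C (γ i))) :
    ∃ z : ℤ, MvPolynomial.aeval γ p = z := by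
  obtain ⟨q, hq⟩ := MvPolynomial.esymmAlgHom_surjective (σ := Fin N) ℤ (n := N) (by simp) ⟨p, hp⟩
  have hq' : p = MvPolynomial.aeval (fun i : Fin N => MvPolynomial.esymm (Fin N) ℤ (i + 1)) q := by
    rw [← MvPolynomial.esymmAlgHom_apply, hq]
  have he (i : Fin N) : MvPolynomial.aeval γ (MvPolynomial.esymm (Fin N) ℤ (i + 1)) =
      (((-1) ^ (i + 1 : ℕ) * G.coeff (N - (i + 1)) : ℤ) : O) := by
    rw [aeval_esymm_eq_coeff ℤ, if_pos (Nat.succ_le_of_lt i.2), ← hG, coeff_map]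
    simp
  refine ⟨MvPolynomial.aeval (fun i : Fin N => (-1) ^ (i + 1 : ℕ) * G.coeff (N - (i + 1))) q, ?_⟩
  rw [hq', ← AlgHom.comp_apply, MvPolynomial.comp_aeval]
  simp only [he]
  have := MvPolynomial.comp_aeval_apply (R := ℤ)
    (fun i : Fin N => (-1) ^ (i + 1 : ℕ) * G.coeff (N - (i + 1))) (Algebra.ofId ℤ O) q
  simpa using this.symm

theorem prod_eval_derivative_prod_X_sub_C {O : Type*} [CommRing O] {N : ℕ} (hN : 4 ∣ N)
    (γ : Fin N → O) :
    ∏ i, (derivative (∏ j, (X - C (γ j)))).eval (γ i) =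
      (∏ j, ∏ i ∈ Finset.Iio j, (γ i - γ j)) ^ 2 := by
  classical
  have hd (i : Fin N) : (derivative (∏ j, (X - C (γ j)))).eval (γ i) =
      ∏ j ∈ {i}ᶜ, (γ i - γ j) := by
    rw [derivative_prod_finset, eval_finsetSum, Finset.sum_eq_single i]
    · simp [eval_prod, Finset.compl_singleton]
    · intro j _ hji
      rw [eval_mul, eval_prod, Finset.prod_eq_zero (i := i)] <;> simp [hji.symm]
    · simp
  have hneg : ∏ j : Fin N, ∏ _i ∈ Finset.Iio j, (-1 : O) = 1 := by
    simp only [Finset.prod_const, Fin.card_Iio]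
    rw [Finset.prod_pow_eq_pow_sum, Fin.sum_univ_eq_sum_range (fun i => i) N]
    refine Even.neg_one_pow ?_
    obtain ⟨k, rfl⟩ := hN
    have h := Finset.sum_range_id_mul_two (4 * k)
    have h' : (∑ i ∈ Finset.range (4 * k), i) = 2 * (k * (4 * k - 1)) := by
      have : (∑ i ∈ Finset.range (4 * k), i) * 2 = 2 * (k * (4 * k - 1)) * 2 := by rw [h]; ring
      omega
    exact h' ▸ even_two_mul _
  calc _ = ∏ i, ∏ j ∈ {i}ᶜ, (γ i - γ j) := Finset.prod_congr rfl fun i _ => hd i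
    _ = ∏ i, ∏ j ∈ Finset.Ioi i, (γ i - γ j) * (γ j - γ i) :=
      (Finset.prod_prod_Ioi_mul_eq_prod_prod_off_diag fun j i => γ i - γ j).symm
    _ = ∏ j, ∏ i ∈ Finset.Iio j, (γ i - γ j) * (γ j - γ i) := Finset.prod_comm' (by simp)
    _ = ∏ j, ∏ i ∈ Finset.Iio j, -1 * (γ i - γ j) ^ 2 :=
      Finset.prod_congr rfl fun j _ => Finset.prod_congr rfl fun i _ => by ring
    _ = _ := by simp only [Finset.prod_mul_distrib, hneg, one_mul, Finset.prod_pow]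

theorem not_eight_dvd_discr_sub_one {O K : Type*} [CommRing O] [IsDomain O] [CharZero O]
    [Field K] [CharP K 2] (φ : O →+* K) {N : ℕ} (hN : Even N) (hN0 : 0 < N) (γ : Fin N → O)
    (G : ℤ[X]) (hG : G.map (Int.castRingHom O) = ∏ i, (X - C (γ i))) (a : K)
    (hγ : ∀ i, φ (γ i) = a ^ 2 ^ (i : ℕ)) (hper : a ^ 2 ^ N = a)
    (hinj : ∀ i j, i < j → j < N → a ^ 2 ^ i ≠ a ^ 2 ^ j) :
    ¬ (8 : O) ∣ (∏ j, ∏ i ∈ Finset.Iio j, (γ i - γ j)) ^ 2 - 1 := by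
  rintro ⟨c, hc⟩
  have h2 : (2 : K) = 0 := CharTwo.two_eq_zero
  have hne (i j : ℕ) (hij : i < j) (hj : j < N) : a ^ 2 ^ i + a ^ 2 ^ j ≠ 0 := fun h =>
    hinj i j hij hj (CharTwo.add_eq_zero.1 h)
  have hδ := sum_div_add_sq_add_self (fun i => a ^ 2 ^ i) hN hN0
    (fun i => by rw [← pow_mul, pow_succ]) (by simpa using hper) hne
  obtain ⟨p, hp⟩ := exists_aeval_eq_intCast_of_isSymmetric (prod_Iio_add_isSymmetric N) G γ hG
  simp only [map_prod, map_add, MvPolynomial.aeval_X] at hp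
  obtain ⟨q, hq, hφq⟩ := exists_prod_add_sub_prod_sub φ
    ((Finset.univ : Finset (Fin N)).sigma Finset.Iio) (fun x => γ x.2) (fun x => γ x.1)
    (by rw [map_ofNat, h2]) (by
      rintro ⟨j, i⟩ h
      simp only [Finset.mem_sigma, Finset.mem_univ, Finset.mem_Iio, true_and] at h
      rw [map_add, hγ, hγ]
      exact hne i j h j.2)
  have hsum : ∑ j : Fin N, ∑ i ∈ Finset.Iio j, φ (γ j) / (φ (γ i) + φ (γ j)) =
      ∑ j ∈ Finset.range N, ∑ i ∈ Finset.range j, a ^ 2 ^ j / (a ^ 2 ^ i + a ^ 2 ^ j) := by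
    rw [Finset.sum_range]
    refine Finset.sum_congr rfl fun j _ => ?_
    rw [← Nat.Iio_eq_range, ← Fin.map_valEmbedding_Iio, Finset.sum_map]
    simp [hγ]
  simp only [Finset.prod_sigma, Finset.sum_sigma, hp, hsum] at hq hφq
  set δ := ∑ j ∈ Finset.range N, ∑ i ∈ Finset.range j, a ^ 2 ^ j / (a ^ 2 ^ i + a ^ 2 ^ j)
  set D := ∏ j, ∏ i ∈ Finset.Iio j, (γ i - γ j)
  have hp0 : (p : K) ≠ 0 := by
    rw [← map_intCast φ, ← hp]
    simp only [map_prod, map_add, hγ]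
    exact Finset.prod_ne_zero_iff.2 fun j _ => Finset.prod_ne_zero_iff.2 fun i hi =>
      hne i j (Fin.lt_def.1 (Finset.mem_Iio.1 hi)) j.2
  have hodd : Odd p := by
    rw [← Int.not_even_iff_odd]
    rintro ⟨r, rfl⟩
    apply hp0
    push_cast
    linear_combination (r : K) * h2
  obtain ⟨e, he⟩ := Int.eight_dvd_sq_sub_one_of_odd hodd
  have he' : (p : O) ^ 2 - 1 = 8 * e := by exact_mod_cast congrArg (Int.cast : ℤ → O) he
  have h4 : (p : O) * q - q ^ 2 = 2 * (e - c) := by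
    have h40 : (4 : O) ≠ 0 := by norm_num
    apply mul_left_cancel₀ h40
    linear_combination he' - hc + (-p - D + 2 * q) * hq
  have h5 := congrArg φ h4
  simp only [map_sub, map_mul, map_pow, map_intCast, map_ofNat, hφq] at h5
  have h6 : (p : K) ^ 2 = 0 := by
    linear_combination h5 - (p : K) ^ 2 * hδ + (e - φ c + p ^ 2 * δ ^ 2) * h2
  exact hp0 (pow_eq_zero_iff two_ne_zero |>.1 h6)

theorem exists_prod_one_add_two_mul {S ι : Type*} [CommRing S] (s : Finset ι) (x : ι → S) :
    ∃ c, ∏ i ∈ s, (1 + 2 * x i) =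
      1 + 2 * ∑ i ∈ s, x i + 2 * ((∑ i ∈ s, x i) ^ 2 - ∑ i ∈ s, x i ^ 2) + 8 * c := by
  classical
  suffices h : ∃ c e, (∑ i ∈ s, x i) ^ 2 - ∑ i ∈ s, x i ^ 2 = 2 * e ∧
      ∏ i ∈ s, (1 + 2 * x i) = 1 + 2 * ∑ i ∈ s, x i + 4 * e + 8 * c by
    obtain ⟨c, e, he, hc⟩ := h
    exact ⟨c, by rw [hc, he]; ring⟩
  induction s using Finset.induction_on with
  | empty => exact ⟨0, 0, by simp⟩
  | insert i s hi ih =>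
    obtain ⟨c, e, he, hc⟩ := ih
    refine ⟨c + x i * e + 2 * x i * c, e + x i * ∑ i ∈ s, x i, ?_, ?_⟩
    · rw [Finset.sum_insert hi, Finset.sum_insert hi]
      linear_combination he
    · rw [Finset.prod_insert hi, Finset.sum_insert hi, hc]
      ring

theorem psum_of_esymm_eq_zero {σ S : Type*} [Fintype σ] [CommRing S] (α : σ → S) {m : ℕ}
    (hm : Odd m)
    (h : ∀ k, 0 < k → k < m → MvPolynomial.aeval α (MvPolynomial.esymm σ S k) = 0) :
    ∑ i, α i ^ m = m * MvPolynomial.aeval α (MvPolynomial.esymm σ S m) ∧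
    ∑ i, α i ^ (2 * m) = m * MvPolynomial.aeval α (MvPolynomial.esymm σ S m) ^ 2 -
      2 * m * MvPolynomial.aeval α (MvPolynomial.esymm σ S (2 * m)) := by
  have key (k : ℕ) (hk : 0 < k) :=
    congrArg (MvPolynomial.aeval α) (MvPolynomial.psum_eq_mul_esymm_sub_sum σ S k hk)
  simp only [map_sub, map_mul, map_sum, map_pow, map_neg, map_one, map_natCast,
    MvPolynomial.psum, MvPolynomial.aeval_X] at key
  have hlow (k : ℕ) (hk : 0 < k) (hkm : k < m) : ∑ i, α i ^ k = 0 := by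
    rw [key k hk, h k hk hkm, Finset.sum_eq_zero, mul_zero, sub_zero]
    rintro ⟨a, b⟩ hab
    simp only [Finset.mem_filter, Set.mem_Ioo] at hab
    rw [h a hab.2.1 (hab.2.2.trans hkm), mul_zero, zero_mul]
  have hpm : ∑ i, α i ^ m = m * MvPolynomial.aeval α (MvPolynomial.esymm σ S m) := by
    rw [key m hm.pos, Finset.sum_eq_zero, hm.add_one.neg_one_pow, one_mul, sub_zero]
    rintro ⟨a, b⟩ hab
    simp only [Finset.mem_filter, Set.mem_Ioo] at hab
    rw [h a hab.2.1 hab.2.2, mul_zero, zero_mul]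
  refine ⟨hpm, ?_⟩
  rw [key (2 * m) (by have := hm.pos; omega), Finset.sum_eq_single (m, m)]
  · rw [hpm, hm.neg_one_pow, Odd.neg_one_pow (by simp)]
    push_cast
    ring
  · rintro ⟨a, b⟩ hab hne
    simp only [Finset.mem_filter, Set.mem_Ioo, ne_eq, Prod.mk.injEq] at hab hne
    have hadd : a + b = 2 * m :=
      Finset.HasAntidiagonal.mem_antidiagonal.1 hab.1
    rcases lt_or_ge a m with ham | ham
    · rw [h a hab.2.1 ham, mul_zero, zero_mul]
    · rw [hlow b (by omega) (by omega), mul_zero]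
  · intro hmm
    exact absurd (by simp [hm.pos, two_mul]) hmm

theorem coeff_comp_X_pow_eq_zero {S : Type*} [CommRing S] {g : S[X]} {d s k : ℕ}
    (hg : d * g.natDegree < s) (hk : s ≤ k) : (g.comp (X ^ d)).coeff k = 0 := by
  refine coeff_eq_zero_of_natDegree_lt (lt_of_le_of_lt natDegree_comp_le ?_)
  refine lt_of_le_of_lt (Nat.mul_le_mul_left _ (natDegree_X_pow_le d)) ?_
  rw [mul_comm]
  omega

theorem Odd.intCast_sq_eq_one {S : Type*} [CommRing S] (h8 : (8 : S) = 0) {z : ℤ} (hz : Odd z) :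
    (z : S) ^ 2 = 1 := by
  obtain ⟨e, he⟩ := Int.eight_dvd_sq_sub_one_of_odd hz
  have := congrArg (Int.cast : ℤ → S) he
  push_cast at this
  linear_combination this + (e : S) * h8

theorem Odd.intCast_pow_eq_one {S : Type*} [CommRing S] (h8 : (8 : S) = 0) {z : ℤ} (hz : Odd z)
    {k : ℕ} (hk : Even k) : (z : S) ^ k = 1 := by
  obtain ⟨r, rfl⟩ := hk
  rw [← two_mul, pow_mul, hz.intCast_sq_eq_one h8, one_pow]

theorem prod_eval_derivative_eq {S : Type*} [CommRing S] (h8 : (8 : S) = 0) {n s m : ℕ}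
    (hs : Odd s) (hsm : s + m = 2 * n) (hm0 : 0 < m) {g f : S[X]} (hg : 8 * g.natDegree < s)
    (hf : f = X ^ (2 * n) + X ^ s + g.comp (X ^ 8) + 1) (t : S) (α : Fin (2 * n) → S)
    (hα : f - C t = ∏ i, (X - C (α i))) :
    ∏ i, (derivative f).eval (α i) = (f.eval 0 - t) ^ (s - 1) *
      (((1 - 2 * n * s * m + 2 * n ^ 2 * s ^ 2 * (m ^ 2 - m) : ℤ) : S) +
        4 * (n ^ 2 * s ^ 2 * m) * if m ≤ n then (f - C t).coeff (2 * n - 2 * m) else 0) := by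
  have hs0 := hs.pos
  have hm : Odd m := by grind
  have hcoeff (k : ℕ) (hk0 : 0 < k) (hk : k ≤ m) :
      (f - C t).coeff (2 * n - k) = if k = m then 1 else 0 := by
    rw [hf]
    simp only [coeff_sub, coeff_add, coeff_X_pow, coeff_one, coeff_C]
    rw [coeff_comp_X_pow_eq_zero hg (by omega)]
    split_ifs <;> first | omega | simp
  obtain ⟨hp, hp2⟩ := psum_of_esymm_eq_zero α hm fun k hk0 hk => by
    rw [aeval_esymm_eq_coeff S, ← hα, hcoeff k hk0 hk.le, if_neg hk.ne]
    simp
  have he : MvPolynomial.aeval α (MvPolynomial.esymm (Fin (2 * n)) S m) = -1 := by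
    rw [aeval_esymm_eq_coeff S, ← hα, hcoeff m hm0 le_rfl, if_pos rfl, if_pos (by omega),
      hm.neg_one_pow, mul_one]
  have he2 : MvPolynomial.aeval α (MvPolynomial.esymm (Fin (2 * n)) S (2 * m)) =
      if m ≤ n then (f - C t).coeff (2 * n - 2 * m) else 0 := by
    rw [aeval_esymm_eq_coeff S, ← hα, Even.neg_one_pow (even_two_mul m), one_mul]
    simp
  rw [← he2]
  rw [he] at hp hp2
  have hss : (s : S) ^ 2 = 1 := by exact_mod_cast (hs.natCast (R := ℤ)).intCast_sq_eq_one h8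
  have hd (i : Fin (2 * n)) : (derivative f).eval (α i) =
      α i ^ (s - 1) * (s * (1 + 2 * (n * s * α i ^ m))) := by
    have h1 : α i ^ (2 * n - 1) = α i ^ (s - 1) * α i ^ m := by
      rw [← pow_add]; congr 1; omega
    rw [hf]
    simp only [derivative_add, derivative_X_pow, derivative_comp, derivative_one, eval_add,
      eval_mul, eval_C, eval_pow, eval_X, eval_zero, h1]
    push_cast
    linear_combination (-2 * n * α i ^ (s - 1) * α i ^ m) * hss +
      (α i ^ 7 * eval (α i) ((derivative g).comp (X ^ 8))) * h8
  have hprod : ∏ i, α i = f.eval 0 - t := by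
    have h := congrArg (eval 0) hα
    simp only [eval_sub, eval_C, eval_prod, eval_X, zero_sub, Finset.prod_neg] at h
    rw [h]
    simp
  obtain ⟨c, hc⟩ := exists_prod_one_add_two_mul Finset.univ fun i => (n * s * α i ^ m : S)
  simp only [← Finset.mul_sum, mul_pow, ← pow_mul, mul_comm m 2, hp, hp2] at hc
  simp only [hd, Finset.prod_mul_distrib, Finset.prod_pow, hprod, hc]
  rw [Finset.prod_const, Finset.card_univ, Fintype.card_fin, pow_mul, hss, one_pow]
  push_cast
  linear_combination (eval 0 f - t) ^ (s - 1) * c * h8 -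
    2 * (n : S) ^ 2 * (m ^ 2 - m) * (eval 0 f - t) ^ (s - 1) * hss

theorem prod_eval_derivative_comp_self_eq_one {S : Type*} [CommRing S] (h8 : (8 : S) = 0)
    {n s : ℕ} (hn : 2 ≤ n) (hs : Odd s) (hsn : s < 2 * n) {g f : S[X]}
    (hg : 8 * g.natDegree < s) (hf : f = X ^ (2 * n) + X ^ s + g.comp (X ^ 8) + 1)
    {z w : ℤ} (hz : Odd z) (hw : Odd w) (hz0 : f.eval 0 = z) (hw0 : (f.comp f).eval 0 = w)
    (β : Fin (2 * n) → S) (hβ : f = ∏ i, (X - C (β i))) (α : Fin (2 * n) → Fin (2 * n) → S)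
    (hα : ∀ j, f - C (β j) = ∏ i, (X - C (α j i))) :
    ∏ j, ∏ i, (derivative (f.comp f)).eval (α j i) = 1 := by
  obtain ⟨m, hsm⟩ : ∃ m, s + m = 2 * n := ⟨2 * n - s, by omega⟩
  have hm0 : 0 < m := by omega
  have hfα (j i : Fin (2 * n)) : f.eval (α j i) = β j := by
    have h := congrArg (eval (α j i)) (hα j)
    rw [eval_prod, Finset.prod_eq_zero (Finset.mem_univ i) (by simp), eval_sub, eval_C] at h
    exact sub_eq_zero.1 h
  have hsplit : ∏ j, ∏ i, (derivative (f.comp f)).eval (α j i) =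
      (∏ j, (derivative f).eval (β j)) ^ (2 * n) * ∏ j, ∏ i, (derivative f).eval (α j i) := by
    simp only [derivative_comp, eval_mul, eval_comp, hfα, Finset.prod_mul_distrib]
    rw [mul_comm]
    simp [Finset.prod_pow]
  set u : ℤ := 1 - 2 * n * s * m + 2 * n ^ 2 * s ^ 2 * (m ^ 2 - m) with hu
  have hu_odd : Odd u := ⟨- n * s * m + n ^ 2 * s ^ 2 * (m ^ 2 - m), by rw [hu]; ring⟩
  have hs1 : Even (s - 1) := by grind
  have hfirst : (∏ j, (derivative f).eval (β j)) ^ 2 = 1 := by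
    rw [prod_eval_derivative_eq h8 hs hsm hm0 hg hf 0 β (by simpa using hβ), hz0, sub_zero,
      hz.intCast_pow_eq_one h8 hs1, one_mul]
    generalize (if m ≤ n then (f - C 0).coeff (2 * n - 2 * m) else 0) = e
    have := hu_odd.intCast_sq_eq_one h8
    linear_combination this +
      (u * (n ^ 2 * s ^ 2 * m) * e + 2 * ((n ^ 2 * s ^ 2 * m) * e) ^ 2) * h8
  have hz_prod : ∏ j, (f.eval 0 - β j) = w := by
    rw [← hw0, eval_comp]
    conv_rhs => rw [hβ]
    rw [eval_prod]
    simp only [eval_sub, eval_X, eval_C]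
    rw [← hβ]
  have hsum : 8 ∣ 4 * ∑ j, if m ≤ n then (f - C (β j)).coeff (2 * n - 2 * m) else 0 := by
    rw [h8, zero_dvd_iff]
    split_ifs with hmn
    · simp only [coeff_sub, Finset.sum_sub_distrib, Finset.sum_const, Finset.card_univ,
        Fintype.card_fin, nsmul_eq_mul]
      have hb : ∑ j, (C (β j)).coeff (2 * n - 2 * m) = 0 := by
        rcases hmn.eq_or_lt with rfl | hlt
        · have h := prod_X_sub_C_coeff_card_pred Finset.univ β (by simp; omega)
          rw [← hβ, Finset.card_univ, Fintype.card_fin] at h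
          simp only [Nat.sub_self, coeff_C_zero]
          rw [← neg_eq_zero, ← h, hf]
          simp only [coeff_add, coeff_X_pow, coeff_one]
          rw [coeff_comp_X_pow_eq_zero hg (by omega)]
          split_ifs <;> first | omega | simp
        · refine Finset.sum_eq_zero fun j _ => ?_
          rw [coeff_C, if_neg (by omega)]
      rw [hb]
      push_cast
      linear_combination (n : S) * coeff f (2 * n - 2 * m) * h8
    · simp
  have hsecond : ∏ j, ∏ i, (derivative f).eval (α j i) = 1 := by
    simp only [fun j => prod_eval_derivative_eq h8 hs hsm hm0 hg hf (β j) (α j) (hα j),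
      Finset.prod_mul_distrib, Finset.prod_pow, hz_prod, hw.intCast_pow_eq_one h8 hs1, one_mul]
    rw [h8, zero_dvd_iff] at hsum
    have hu2 := hu_odd.intCast_sq_eq_one h8
    have hfac (e : S) : (u : S) + 4 * (n ^ 2 * s ^ 2 * m) * e =
        u * (1 + 2 * (2 * u * (n ^ 2 * s ^ 2 * m) * e)) := by
      linear_combination (- 4 * (n ^ 2 * s ^ 2 * m) * e) * hu2
    obtain ⟨c, hc⟩ := exists_prod_one_add_two_mul Finset.univ fun j : Fin (2 * n) =>
      (2 * u * (n ^ 2 * s ^ 2 * m) *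
        if m ≤ n then (f - C (β j)).coeff (2 * n - 2 * m) else 0 : S)
    simp only [← hu, hfac, Finset.prod_mul_distrib, hc]
    simp only [mul_pow, ← Finset.mul_sum]
    rw [Finset.prod_const, Finset.card_univ, Fintype.card_fin,
      hu_odd.intCast_pow_eq_one h8 (even_two_mul n)]
    generalize ∑ j, (if m ≤ n then (f - C (β j)).coeff (2 * n - 2 * m) else 0) ^ 2 = q at *
    linear_combination (u * (n ^ 2 * s ^ 2 * m) : S) * hsum + (c + u ^ 2 * (n ^ 2 * s ^ 2 * m) ^ 2 *
      ((∑ j, if m ≤ n then (f - C (β j)).coeff (2 * n - 2 * m) else 0) ^ 2 - q)) * h8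
  rw [hsplit, hsecond, pow_mul, hfirst, one_pow, one_mul]

theorem exists_eq_prod_X_sub_C_integralClosure {N : ℕ} {p : (integralClosure ℤ ℂ)[X]}
    (hp : p.Monic) (hN : p.natDegree = N) :
    ∃ α : Fin N → integralClosure ℤ ℂ, p = ∏ i, (X - C (α i)) := by
  set ψ := algebraMap (integralClosure ℤ ℂ) ℂ
  have hsplit := IsAlgClosed.splits (p.map ψ)
  have hroots := hsplit.eq_prod_roots_of_monic (hp.map ψ)
  have hcard := hsplit.natDegree_eq_card_roots
  rw [hp.natDegree_map, hN] at hcard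
  have hrint (r : ℂ) (hr : r ∈ (p.map ψ).roots) : r ∈ integralClosure ℤ ℂ := by
    have h : IsIntegral (integralClosure ℤ ℂ) r :=
      ⟨p, hp, by simpa [eval_map] using isRoot_of_mem_roots hr⟩
    exact isIntegral_trans r h
  obtain ⟨l, hl⟩ := Quot.exists_rep (p.map ψ).roots
  change (l : Multiset ℂ) = _ at hl
  rw [← hl] at hroots hcard hrint
  rw [Multiset.coe_card] at hcard
  subst hcard
  refine ⟨fun i => ⟨l.get i, hrint _ (by simp)⟩, map_injective ψ Subtype.val_injective ?_⟩
  rw [hroots, Polynomial.map_prod]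
  simp only [Polynomial.map_sub, map_X, map_C, Multiset.map_coe, Multiset.prod_coe]
  rw [← List.prod_ofFn]
  congr 1
  exact List.ext_get (by simp) fun i _ _ => by simp [ψ]

theorem aeval_pow_two_pow_eq_zero {K : Type*} [CommRing K] [Algebra (ZMod 2) K] {F : (ZMod 2)[X]}
    {a : K} (ha : aeval a F = 0) (i : ℕ) : aeval (a ^ 2 ^ i) F = 0 := by
  induction i with
  | zero => simpa using ha
  | succ i ih =>
    have h := aeval_algHom_apply (FiniteField.frobeniusAlgHom (ZMod 2) K) (a ^ 2 ^ i) F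
    rw [ih, map_zero, FiniteField.frobeniusAlgHom_apply, ZMod.card, ← pow_mul, ← pow_succ] at h
    exact h

theorem Irreducible.pow_two_pow_natDegree_eq {K : Type*} [Field K] [Algebra (ZMod 2) K]
    {F : (ZMod 2)[X]} (hF : Irreducible F) {a : K} (ha : aeval a F = 0) :
    a ^ 2 ^ F.natDegree = a := by
  have h := (hF.dvd_iff_aeval_eq_zero ha).2
    (hF.natDegree_dvd_iff_dvd_X_pow_card_pow_sub_X.1 dvd_rfl)
  simpa [sub_eq_zero] using h

theorem Irreducible.pow_two_pow_ne {K : Type*} [Field K] [CharP K 2] [Algebra (ZMod 2) K]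
    {F : (ZMod 2)[X]} (hF : Irreducible F) {a : K} (ha : aeval a F = 0) {i j : ℕ} (hij : i < j)
    (hj : j < F.natDegree) : a ^ 2 ^ i ≠ a ^ 2 ^ j := by
  intro h
  obtain ⟨d, rfl⟩ := Nat.exists_eq_add_of_lt hij
  have h1 : (a ^ 2 ^ (d + 1) - a) ^ 2 ^ i = 0 := by
    rw [sub_pow_char_pow, ← pow_mul, ← pow_add, h, sub_eq_zero]
    congr 2
    omega
  have h2 := pow_eq_zero_iff (by positivity) |>.1 h1
  have h3 : F ∣ X ^ Nat.card (ZMod 2) ^ (d + 1) - X :=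
    (hF.dvd_iff_aeval_eq_zero ha).1 (by simpa using h2)
  have h4 := Nat.le_of_dvd (by omega) (hF.natDegree_dvd_of_dvd_X_pow_card_pow_sub_X h3)
  omega

theorem Irreducible.odd_eval_zero {p : (ZMod 2)[X]} (hp : Irreducible p) (hdeg : 1 < p.natDegree)
    {P : ℤ[X]} (hP : P.map (Int.castRingHom (ZMod 2)) = p) : Odd (P.eval 0) := by
  rw [← Int.not_even_iff_odd]
  intro h
  have hroot : p.IsRoot 0 := by
    rw [IsRoot, ← hP, ← coeff_zero_eq_eval_zero, coeff_map, coeff_zero_eq_eval_zero, eq_intCast,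
      ZMod.intCast_zmod_eq_zero_iff_dvd]
    exact_mod_cast h.two_dvd
  have : p.natDegree = 1 := natDegree_eq_of_degree_eq_some
    (degree_eq_one_of_irreducible_of_root hp hroot)
  omega

theorem exists_isMaximal_charP_two_quotient_integralClosure :
    ∃ M : Ideal (integralClosure ℤ ℂ), M.IsMaximal ∧
      CharP (integralClosure ℤ ℂ ⧸ M) 2 := by
  have hmax : (Ideal.span {(2 : ℤ)}).IsMaximal :=
    PrincipalIdealRing.isMaximal_of_irreducible Int.prime_two.irreducible
  obtain ⟨M, hM, hcomap⟩ := Ideal.exists_ideal_over_maximal_of_isIntegral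
    (S := integralClosure ℤ ℂ) (Ideal.span {(2 : ℤ)}) (by
      rw [(RingHom.injective_iff_ker_eq_bot _).1 (algebraMap ℤ (integralClosure ℤ ℂ)).injective_int]
      exact bot_le)
  refine ⟨M, hM, CharTwo.of_one_ne_zero_of_two_eq_zero
    (one_ne_zero (α := integralClosure ℤ ℂ ⧸ M)) ?_⟩
  have h : (2 : ℤ) ∈ Ideal.comap (algebraMap ℤ (integralClosure ℤ ℂ)) M := by
    rw [hcomap]; exact Ideal.mem_span_singleton_self 2
  have h' := Ideal.Quotient.eq_zero_iff_mem.2 (Ideal.mem_comap.1 h)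
  rw [← map_ofNat (Ideal.Quotient.mk M)]
  simpa using h'

theorem not_irreducible_comp_self {n s : ℕ} (hn : 2 ≤ n) (hs : Odd s) (hsn : s < 2 * n)
    {g f : (ZMod 2)[X]} (hg : 8 * g.natDegree < s)
    (hf : f = X ^ (2 * n) + X ^ s + g.comp (X ^ 8) + 1) (hirr : Irreducible f) :
    ¬ Irreducible (f.comp f) := by
  intro hirr2
  obtain ⟨g', hg'map, hg'deg⟩ := exists_natDegree_eq_of_mem_lifts
    (mem_lifts_of_surjective (f := Int.castRingHom (ZMod 2)) (ZMod.ringHom_surjective _) g)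
  rw [← hg'deg] at hg
  set P : ℤ[X] := X ^ (2 * n) + X ^ s + g'.comp (X ^ 8) + 1 with hP
  have hPf : P.map (Int.castRingHom (ZMod 2)) = f := by
    simp [hP, hf, Polynomial.map_comp, hg'map]
  have hPPf : (P.comp P).map (Int.castRingHom (ZMod 2)) = f.comp f := by
    rw [Polynomial.map_comp, hPf]
  have hlow : (X ^ s + g'.comp (X ^ 8) + 1 : ℤ[X]).natDegree < 2 * n := by
    refine lt_of_le_of_lt (natDegree_add_le_of_degree_le (natDegree_add_le_of_degree_le
      (natDegree_X_pow_le s) (natDegree_comp_le.trans ?_)) (by simp)) hsn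
    rw [natDegree_X_pow, mul_comm]
    exact hg.le
  have hPeq : P = X ^ (2 * n) + (X ^ s + g'.comp (X ^ 8) + 1) := by rw [hP]; ring
  have hPmonic : P.Monic := by
    rw [hPeq]
    exact monic_X_pow_add (degree_le_natDegree.trans_lt (by exact_mod_cast hlow))
  have hPdeg : P.natDegree = 2 * n := by
    rw [hPeq, natDegree_add_eq_left_of_natDegree_lt] <;> simp [hlow]
  have hfdeg : f.natDegree = 2 * n := by rw [← hPf, hPmonic.natDegree_map, hPdeg]
  have hffdeg : (f.comp f).natDegree = 2 * n * (2 * n) := by rw [natDegree_comp, hfdeg]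
  let O := integralClosure ℤ ℂ
  set Q : O[X] := P.map (Int.castRingHom O) with hQ
  have hQmonic : Q.Monic := hPmonic.map _
  have hQdeg : Q.natDegree = 2 * n := by rw [hQ, hPmonic.natDegree_map, hPdeg]
  obtain ⟨β, hβ⟩ := exists_eq_prod_X_sub_C_integralClosure hQmonic hQdeg
  have hα' (j : Fin (2 * n)) : ∃ α : Fin (2 * n) → O, Q - C (β j) = ∏ i, (X - C (α i)) := by
    refine exists_eq_prod_X_sub_C_integralClosure (hQmonic.sub_of_left ?_) ?_
    · exact degree_C_le.trans_lt (natDegree_pos_iff_degree_pos.1 (by omega))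
    · rw [natDegree_sub_C, hQdeg]
  choose α hα using hα'
  have hQQ : Q.comp Q = ∏ x : Fin (2 * n) × Fin (2 * n), (X - C (α x.1 x.2)) := by
    rw [Fintype.prod_prod_type]
    simp only [← hα]
    conv_lhs => rw [hβ, prod_comp]
    simp only [sub_comp, X_comp, C_comp]
    rw [← hβ]
  obtain ⟨M, hM, hchar⟩ := exists_isMaximal_charP_two_quotient_integralClosure
  let : Field (O ⧸ M) := Ideal.Quotient.field M
  let : Algebra (ZMod 2) (O ⧸ M) := ZMod.algebra _ 2
  let φ : O →+* O ⧸ M := Ideal.Quotient.mk M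
  have hroot (b : O ⧸ M) : aeval b (f.comp f) = ∏ x : Fin (2 * n) × Fin (2 * n),
      (b - φ (α x.1 x.2)) := by
    rw [← eval_map_algebraMap, ← hPPf, Polynomial.map_map]
    have h : ((algebraMap (ZMod 2) (O ⧸ M)).comp (Int.castRingHom (ZMod 2))) =
      φ.comp (Int.castRingHom O) := RingHom.ext_int _ _
    rw [h, ← Polynomial.map_map, Polynomial.map_comp, ← hQ, hQQ, Polynomial.map_prod, eval_prod]
    simp
  have h0 : 0 < 2 * n := by omega
  set a : O ⧸ M := φ (α ⟨0, h0⟩ ⟨0, h0⟩)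
  have ha : aeval a (f.comp f) = 0 := by
    rw [hroot]
    exact Finset.prod_eq_zero (Finset.mem_univ (⟨0, h0⟩, ⟨0, h0⟩)) (sub_self _)
  have hidx (i : Fin (2 * n * (2 * n))) :
      ∃ x : Fin (2 * n) × Fin (2 * n), φ (α x.1 x.2) = a ^ 2 ^ (i : ℕ) := by
    have h := aeval_pow_two_pow_eq_zero ha i
    rw [hroot, Finset.prod_eq_zero_iff] at h
    obtain ⟨x, -, hx⟩ := h
    exact ⟨x, (sub_eq_zero.1 hx).symm⟩
  choose e he using hidx
  have hne (i j : ℕ) (hij : i < j) (hj : j < 2 * n * (2 * n)) : a ^ 2 ^ i ≠ a ^ 2 ^ j :=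
    hirr2.pow_two_pow_ne ha hij (by rwa [hffdeg])
  have hinj : Function.Injective e := by
    intro i j hij
    have h : a ^ 2 ^ (i : ℕ) = a ^ 2 ^ (j : ℕ) := by rw [← he, ← he, hij]
    rcases lt_trichotomy i j with hlt | heq | hlt
    · exact absurd h (hne i j hlt j.2)
    · exact heq
    · exact absurd h.symm (hne j i hlt i.2)
  have hbij : Function.Bijective e :=
    (Fintype.bijective_iff_injective_and_card e).2 ⟨hinj, by simp⟩
  let γ : Fin (2 * n * (2 * n)) → O := fun i => α (e i).1 (e i).2
  have hγ : Q.comp Q = ∏ i, (X - C (γ i)) := by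
    rw [hQQ]
    exact (hbij.prod_comp fun x : Fin (2 * n) × Fin (2 * n) => (X - C (α x.1 x.2))).symm
  have hper := hirr2.pow_two_pow_natDegree_eq ha
  rw [hffdeg] at hper
  refine not_eight_dvd_discr_sub_one φ (even_two_mul n |>.mul_right _) (by positivity) γ
    (P.comp P) (by rw [Polynomial.map_comp, ← hQ, hγ]) a he hper hne ?_
  rw [← prod_eval_derivative_prod_X_sub_C ⟨n * n, by ring⟩ γ, ← hγ,
    hbij.prod_comp fun x : Fin (2 * n) × Fin (2 * n) =>
      (derivative (Q.comp Q)).eval (α x.1 x.2), Fintype.prod_prod_type,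
    ← Ideal.mem_span_singleton, ← Ideal.Quotient.eq]
  let π := Ideal.Quotient.mk (Ideal.span {(8 : O)})
  have h8 : (8 : O ⧸ Ideal.span {(8 : O)}) = 0 := by
    rw [← map_ofNat π]
    exact Ideal.Quotient.eq_zero_iff_mem.2 (Ideal.mem_span_singleton_self 8)
  have hPQ : P.map (Int.castRingHom (O ⧸ Ideal.span {(8 : O)})) = Q.map π := by
    rw [hQ, Polynomial.map_map]
    congr 1
  have heval (R : ℤ[X]) : (R.map (Int.castRingHom (O ⧸ Ideal.span {(8 : O)}))).eval 0 =
      (R.eval 0 : ℤ) := by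
    rw [← map_zero (Int.castRingHom _), eval_map_apply, eq_intCast]
  have hfinal := prod_eval_derivative_comp_self_eq_one h8 hn hs hsn
    (g := g'.map (Int.castRingHom _)) (f := Q.map π)
    (lt_of_le_of_lt (Nat.mul_le_mul_left 8 natDegree_map_le) hg)
    (by rw [← hPQ, hP]; simp [Polynomial.map_comp])
    (hirr.odd_eval_zero (by omega) hPf) (hirr2.odd_eval_zero (by rw [hffdeg]; nlinarith) hPPf)
    (by rw [← hPQ, heval]) (by rw [← hPQ, ← Polynomial.map_comp, heval])
    (fun j => π (β j)) (by simpa [Polynomial.map_prod] using congrArg (Polynomial.map π) hβ)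
    (fun j i => π (α j i)) (fun j => by
      simpa [Polynomial.map_prod] using congrArg (Polynomial.map π) (hα j))
  rw [← Polynomial.map_comp, derivative_map] at hfinal
  simpa [eval_map_apply] using hfinal

theorem higher_weight_not_stable_one
    (n s : ℕ) (hn : 1 ≤ n)
    (g : Polynomial (ZMod 2))
    (hs1 : 8 * g.natDegree < s) (hs2 : s < 2 * n)
    (f : Polynomial (ZMod 2))
    (hf : f = X ^ (2 * n) + X ^ s + g.comp (X ^ 8) + 1) :
    ¬ (∀ k : ℕ, 1 ≤ k → Irreducible ((fun q => f.comp q)^[k] (X : Polynomial (ZMod 2)))) := by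
  intro hstable
  have h2 : (2 : (ZMod 2)[X]) = 0 := CharTwo.two_eq_zero
  have hirr : Irreducible f := by simpa using hstable 1 le_rfl
  have hirr2 : Irreducible (f.comp f) := by simpa using hstable 2 one_le_two
  have hs : Odd s := by
    rw [← Nat.not_even_iff_odd]
    rintro ⟨r, rfl⟩
    refine (separable_iff_derivative_ne_zero hirr).1 (PerfectField.separable_of_irreducible hirr) ?_
    rw [hf]
    simp only [derivative_add, derivative_X_pow, derivative_comp, derivative_one, map_natCast]
    push_cast
    linear_combination (n * X ^ (2 * n - 1) + r * X ^ (r + r - 1) +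
      4 * X ^ 7 * (derivative g).comp (X ^ 8)) * h2
  rcases hn.eq_or_lt with rfl | hn
  · obtain rfl : s = 1 := by omega
    rw [eq_C_of_natDegree_eq_zero (show g.natDegree = 0 by omega)] at hf
    have hc : g.coeff 0 = 0 := by
      by_contra hc
      have hc1 : g.coeff 0 = 1 := by
        generalize g.coeff 0 = c at hc
        revert c; decide
      rw [hc1] at hf
      have hfX : f = X * (X + 1) := by
        rw [hf]
        simp only [C_1, one_comp]
        linear_combination h2
      rw [hfX] at hirr
      rcases hirr.isUnit_or_isUnit rfl with h | h
      · exact not_isUnit_X h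
      · exact not_isUnit_X_add_C (1 : ZMod 2) (by simpa using h)
    have hirr3 : Irreducible (f.comp (f.comp f)) := by simpa using hstable 3 (by norm_num)
    have hfac : f.comp (f.comp f) = (X ^ 4 + X ^ 3 + 1) * (X ^ 4 + X ^ 3 + X ^ 2 + X + 1) := by
      rw [hf, hc]
      simp only [map_zero, zero_comp, add_comp, pow_comp, X_comp, one_comp]
      linear_combination (X ^ 7 + 5 * X ^ 6 + 10 * X ^ 5 + 16 * X ^ 4 + 18 * X ^ 3 + 18 * X ^ 2 +
        10 * X + 6) * h2
    have hd1 : (X ^ 4 + X ^ 3 + 1 : (ZMod 2)[X]).natDegree = 4 := by compute_degree!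
    have hd2 : (X ^ 4 + X ^ 3 + X ^ 2 + X + 1 : (ZMod 2)[X]).natDegree = 4 := by compute_degree!
    rcases hirr3.isUnit_or_isUnit hfac with h | h
    · have := natDegree_eq_zero_of_isUnit h
      omega
    · have := natDegree_eq_zero_of_isUnit h
      omega
  · exact not_irreducible_comp_self hn hs hs2 hs1 hf hirr hirr2
end

section
/- Let g(x) ∈ F_2[x] be a monic polynomial of degree d ≥ 1, and let s be an integer with 1 ≤ s < 4d. Then the polynomial f(x) = g(x^4) + x^s + 1 ∈ F_2[x] is not stable over F_2. -/
open Polynomial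

theorem exists_prod_add_mul_eq {ι R : Type*} [DecidableEq ι] [CommRing R] (s : Finset ι)
    (v m : ι → R) (y : R) :
    ∃ t, ∏ i ∈ s, (v i + m i * y) =
      ∏ i ∈ s, v i + (∑ i ∈ s, m i * ∏ j ∈ s.erase i, v j) * y + t * y ^ 2 := by
  obtain ⟨t, ht⟩ := binomExpansion (∏ i ∈ s, (C (v i) + C (m i) * X)) 0 y
  refine ⟨t, ?_⟩
  simpa [eval_prod, derivative_prod_finset, eval_finsetSum, mul_comm (∏ j ∈ s.erase _, v j)]
    using ht

theorem sum_eval_mul_prod_erase_eq_zero {ι R : Type*} [Fintype ι] [DecidableEq ι] [CommRing R]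
    [IsDomain R] (b : ι → R) (hb : Function.Injective b) (M : R[X])
    (hM : M.natDegree + 1 < Fintype.card ι) :
    ∑ i, M.eval (b i) * ∏ j ∈ Finset.univ.erase i, ∏ k ∈ Finset.univ.erase j, (b j - b k) = 0 := by
  let K := FractionRing R
  have hinj : Function.Injective (algebraMap R K) := IsFractionRing.injective R K
  apply hinj
  have hv : Set.InjOn (fun i => algebraMap R K (b i)) (Finset.univ : Finset ι) :=
    (hinj.comp hb).injOn
  have hdeg : (M.map (algebraMap R K)).natDegree = M.natDegree := natDegree_map_eq_of_injective hinj M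
  have h := Lagrange.coeff_eq_sum hv (P := M.map (algebraMap R K))
    (lt_of_le_of_lt degree_le_natDegree (by
      rw [hdeg, Finset.card_univ]; exact_mod_cast (Nat.lt_of_succ_lt hM)))
  rw [coeff_eq_zero_of_natDegree_lt (by rw [hdeg, Finset.card_univ]; omega)] at h
  have hne : ∀ j, ∏ k ∈ Finset.univ.erase j, (algebraMap R K (b j) - algebraMap R K (b k)) ≠ 0 := by
    intro j
    refine Finset.prod_ne_zero_iff.2 fun k hk => sub_ne_zero.2 fun h => ?_
    exact (Finset.ne_of_mem_erase hk) (hb (hinj h)).symm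
  calc _ = (∑ i, (M.map (algebraMap R K)).eval (algebraMap R K (b i)) /
          ∏ k ∈ Finset.univ.erase i, (algebraMap R K (b i) - algebraMap R K (b k))) *
        ∏ j, ∏ k ∈ Finset.univ.erase j, (algebraMap R K (b j) - algebraMap R K (b k)) := by
        rw [Finset.sum_mul, map_sum]
        refine Finset.sum_congr rfl fun i _ => ?_
        rw [← Finset.mul_prod_erase _ _ (Finset.mem_univ i), ← mul_assoc, div_mul_cancel₀ _ (hne i)]
        simp [map_prod, aeval_algebraMap_apply]
    _ = _ := by rw [← h, zero_mul, map_zero]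

theorem sq_prod_sub_eq_prod_prod_erase {R : Type*} [CommRing R] {n : ℕ} (hn : 4 ∣ n)
    (b : Fin n → R) :
    (∏ i, ∏ j ∈ Finset.Ioi i, (b j - b i)) ^ 2 =
      ∏ i, ∏ j ∈ Finset.univ.erase i, (b i - b j) := by
  have hsign : ∏ i : Fin n, ∏ j ∈ Finset.Ioi i, (-1 : R) = 1 := by
    simp only [Finset.prod_const, Fin.card_Ioi, Finset.prod_pow_eq_pow_sum]
    apply Even.neg_one_pow
    rw [Fin.sum_univ_eq_sum_range (fun i => n - 1 - i), Finset.sum_range_reflect (fun i => i),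
      Finset.sum_range_id]
    obtain ⟨k, rfl⟩ := hn
    rw [show 4 * k * (4 * k - 1) = 2 * (2 * (k * (4 * k - 1))) by ring]
    simp
  have h := Finset.prod_prod_Ioi_mul_eq_prod_prod_off_diag (fun i j => b j - b i)
  have h2 : ∏ i, ∏ j ∈ Finset.univ.erase i, (b i - b j) = ∏ i, ∏ j ∈ {i}ᶜ, (b i - b j) := by
    refine Finset.prod_congr rfl fun i _ => Finset.prod_congr ?_ fun _ _ => rfl
    ext; simp
  rw [h2, ← h, ← one_mul (_ ^ 2), ← hsign, ← Finset.prod_pow, ← Finset.prod_mul_distrib]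
  refine Finset.prod_congr rfl fun i _ => ?_
  rw [← Finset.prod_pow, ← Finset.prod_mul_distrib]
  refine Finset.prod_congr rfl fun j _ => by ring

theorem not_derivative_eq_sq_add_of_frobenius_cycle {W : Type*} [CommRing W] [IsDomain W]
    (h2 : Prime (2 : W)) (φ : W →+* W) {n : ℕ} (hn : 4 ∣ n) (b : Fin n → W)
    (hφ : ∀ i, φ (b i) = b (finRotate n i)) (hb : ∀ i j, i ≠ j → ¬ (2 : W) ∣ b i - b j)
    (H A M R : ℤ[X]) (hH : H.map (Int.castRingHom W) = ∏ i, (X - C (b i)))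
    (hM : M.natDegree + 1 < n) : derivative H ≠ A ^ 2 + 4 * M + 8 * R := by
  intro hder
  have hinj : Function.Injective b := fun i j hij => by
    by_contra hne
    exact hb i j hne (by simp [hij])
  set δ := ∏ i, ∏ j ∈ Finset.Ioi i, (b j - b i) with hδ
  set E := ∏ i, aeval (b i) A with hE
  set v : Fin n → W := fun i => ∏ j ∈ Finset.univ.erase i, (b i - b j) with hv
  have hφδ : φ δ = -δ := by
    have h := Equiv.Perm.prod_Ioi_comp_eq_sign_mul_prod (finRotate n)
      (f := fun i j => b j - b i) (fun i j => by ring)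
    rw [sign_finRotate, Odd.neg_one_pow (by
      obtain ⟨k, rfl⟩ := hn
      exact Nat.Even.sub_odd (by omega) ⟨2 * k, by ring⟩ odd_one)] at h
    simp only [hδ, map_prod, map_sub, hφ]
    simpa using h
  have hφE : φ E = E := by
    have h (i) : φ (aeval (b i) A) = aeval (b (finRotate n i)) A := by
      rw [← hφ]
      exact (aeval_algHom_apply φ.toIntAlgHom (b i) A).symm
    simp only [hE, map_prod, h]
    exact Equiv.prod_comp (finRotate n) (fun i => aeval (b i) A)
  have hδ2 : ¬ (2 : W) ∣ δ := by
    simp only [hδ, h2.dvd_finsetProd_iff, not_exists, not_and]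
    intro i _ j hj
    exact hb j i (Finset.mem_Ioi.1 hj).ne'
  have hvder (i) : v i = aeval (b i) (derivative H) := by
    rw [aeval_def, ← eval_map, algebraMap_int_eq, ← derivative_map, hH, derivative_prod_finset,
      eval_finsetSum, Finset.sum_eq_single i]
    · simp [eval_prod, hv]
    · intro j _ hj
      simp only [derivative_X_sub_C, mul_one, eval_prod]
      exact Finset.prod_eq_zero (i := i) (by simp [hj.symm]) (by simp)
    · simp
  have hvA (i) : v i = aeval (b i) A ^ 2 + 4 * aeval (b i) M + 8 * aeval (b i) R := by
    simp only [hvder, hder, map_add, map_mul, map_pow, map_ofNat]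
  obtain ⟨t, ht⟩ := exists_prod_add_mul_eq Finset.univ v (fun i => - aeval (b i) M) 4
  obtain ⟨u, hu⟩ := exists_prod_add_mul_eq Finset.univ (fun i => aeval (b i) A ^ 2)
    (fun i => aeval (b i) R) 8
  have hLag := sum_eval_mul_prod_erase_eq_zero b hinj (M.map (Int.castRingHom W))
    (by
      rw [Fintype.card_fin]
      exact lt_of_le_of_lt (Nat.succ_le_succ (natDegree_map_le)) hM)
  have hsum : ∑ i, -aeval (b i) M * ∏ j ∈ Finset.univ.erase i, v j = 0 := by
    simp only [neg_mul, Finset.sum_neg_distrib, neg_eq_zero]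
    simpa [eval_map, aeval_def] using hLag
  have hprod : ∏ i, (v i + -aeval (b i) M * 4) =
      ∏ i, (aeval (b i) A ^ 2 + aeval (b i) R * 8) :=
    Finset.prod_congr rfl fun i _ => by rw [hvA]; ring
  rw [ht, hu, hsum, Finset.prod_pow, ← hE, ← sq_prod_sub_eq_prod_prod_erase hn b, ← hδ] at hprod
  obtain ⟨w, hw⟩ : ∃ w, (δ - E) * (δ + E) = 8 * w :=
    ⟨∑ i, aeval (b i) R * ∏ j ∈ Finset.univ.erase i, aeval (b j) A ^ 2 + u * 8 - 2 * t, by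
      linear_combination hprod⟩
  have key : ∀ e : W, φ e = e → ¬ (4 : W) ∣ δ - e := by
    rintro e he ⟨x, hx⟩
    have h1 := congrArg φ hx
    rw [map_sub, hφδ, he, map_mul, map_ofNat] at h1
    apply hδ2
    refine ⟨x - φ x, mul_left_cancel₀ h2.ne_zero ?_⟩
    linear_combination hx - h1
  have hdvd : (2 : W) ∣ δ - E := by
    rcases h2.dvd_or_dvd (a := δ - E) (b := δ + E) ⟨4 * w, by rw [hw]; ring⟩ with h | h
    · exact h
    · obtain ⟨c, hc⟩ := h
      exact ⟨c - E, by linear_combination hc⟩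
  obtain ⟨x, hx⟩ := hdvd
  have hxw : x * (x + E) = 2 * w := by
    apply mul_left_cancel₀ (pow_ne_zero 2 h2.ne_zero)
    linear_combination hw - (δ + E) * hx - 2 * x * hx
  rcases h2.dvd_or_dvd (⟨w, hxw⟩ : (2 : W) ∣ x * (x + E)) with ⟨c, hc⟩ | ⟨c, hc⟩
  · exact key E hφE ⟨c, by linear_combination hx + 2 * hc⟩
  · exact key (-E) (by rw [map_neg, hφE]) ⟨c, by linear_combination hx + 2 * hc⟩

theorem Irreducible.iterate_frobenius_ne {k K : Type*} [Field k] [Finite k] [Field K]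
    [Algebra k K] {h : k[X]} (hh : Irreducible h) {a : K} (ha : aeval a h = 0) {m : ℕ} (hm : m ≠ 0)
    (hmn : m < h.natDegree) : a ^ Nat.card k ^ m ≠ a := by
  intro heq
  have hdvd : h ∣ X ^ Nat.card k ^ m - X := by
    have h1 := minpoly.dvd k a (p := X ^ Nat.card k ^ m - X) (by simp [heq])
    exact (((minpoly.irreducible (IsAlgebraic.isIntegral ⟨h, hh.ne_zero, ha⟩)).associated_of_dvd hh
      (minpoly.dvd k a ha)).symm.dvd).trans h1
  exact hmn.not_ge (Nat.le_of_dvd (Nat.pos_of_ne_zero hm)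
    (hh.natDegree_dvd_of_dvd_X_pow_card_pow_sub_X hdvd))

theorem exists_frobenius_cycle_roots {H : ℤ[X]} (hH : H.Monic)
    (hirr : Irreducible (H.map (Int.castRingHom (ZMod 2)))) :
    ∃ b : Fin H.natDegree → WittVector 2 (AlgebraicClosure (ZMod 2)),
      (∀ i, WittVector.frobenius (b i) = b (finRotate _ i)) ∧
      (∀ i j, i ≠ j → ¬ 2 ∣ b i - b j) ∧
      H.map (Int.castRingHom _) = ∏ i, (X - C (b i)) := by
  let k := AlgebraicClosure (ZMod 2)
  let W := WittVector 2 k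
  let π : W →+* k := WittVector.constantCoeff
  have hπ (x : W) : (2 : W) ∣ x ↔ π x = 0 := by
    have h := WittVector.mem_span_p_iff_coeff_zero_eq_zero (p := 2) x
    rw [Ideal.mem_span_singleton] at h
    exact_mod_cast h
  have hπφ (x : W) : π (WittVector.frobenius x) = π x ^ 2 :=
    WittVector.coeff_frobenius_charP 2 x 0
  set h := H.map (Int.castRingHom (ZMod 2)) with hh
  have hdeg : h.natDegree = H.natDegree := hH.natDegree_map _
  obtain ⟨a, ha⟩ := IsAlgClosed.exists_aeval_eq_zero k h (degree_pos_of_irreducible hirr).ne'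
  have hred (x : W) (P : ℤ[X]) : π (aeval x P) = aeval (π x) (P.map (Int.castRingHom (ZMod 2))) := by
    have h1 : π (aeval x P) = aeval (π x) P := (aeval_algHom_apply π.toIntAlgHom x P).symm
    rw [h1]
    exact (aeval_map_algebraMap (ZMod 2) (π x) P).symm
  obtain ⟨a₀, ha₀⟩ : ∃ a₀ : W, π a₀ = a := WittVector.constantCoeff_surjective 2 a
  have hsep : aeval a (derivative h) ≠ 0 :=
    (PerfectField.separable_of_irreducible hirr).aeval_derivative_ne_zero ha
  obtain ⟨b₀, hb₀, hb₀a⟩ := HenselianRing.is_henselian (I := Ideal.span {((2 : ℕ) : W)})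
    (H.map (Int.castRingHom W)) (hH.map _) a₀
    (by
      rw [Ideal.mem_span_singleton, Nat.cast_ofNat, hπ, eval_map, ← algebraMap_int_eq, ← aeval_def,
        hred, ha₀, ha])
    (by
      apply IsUnit.map
      apply WittVector.isUnit_of_coeff_zero_ne_zero
      change π _ ≠ 0
      rw [derivative_map, eval_map, ← algebraMap_int_eq, ← aeval_def, hred, ha₀, ← derivative_map]
      exact hsep)
  have hπb₀ : π b₀ = a := by
    rw [Ideal.mem_span_singleton, Nat.cast_ofNat, hπ, map_sub, ha₀, sub_eq_zero] at hb₀a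
    exact hb₀a
  let φ : W →+* W := WittVector.frobenius
  let c : ℕ → W := fun i => φ^[i] b₀
  have hcroot (i : ℕ) : aeval (c i) H = 0 := by
    induction i with
    | zero => rw [aeval_def, ← eval_map]; exact hb₀
    | succ i ih =>
      simp only [c, Function.iterate_succ_apply']
      have h1 := aeval_algHom_apply φ.toIntAlgHom (c i) H
      rw [ih, map_zero] at h1
      exact h1
  have hπc (i : ℕ) : π (c i) = a ^ 2 ^ i := by
    induction i with
    | zero => simpa [c] using hπb₀
    | succ i ih =>
      simp only [c, Function.iterate_succ_apply']
      rw [hπφ]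
      change π (c i) ^ 2 = _
      rw [ih, ← pow_mul, pow_succ]
  have hne (i m : ℕ) (hm : m ≠ 0) (hmn : m < H.natDegree) : π (c i) ≠ π (c (i + m)) := by
    rw [hπc, hπc, pow_add, mul_comm, pow_mul]
    intro heq
    have h1 : a ^ 2 ^ m = a := iterateFrobenius_inj k 2 i (by simpa [iterateFrobenius_def] using heq.symm)
    exact hirr.iterate_frobenius_ne ha hm (hdeg ▸ hmn) (by simpa using h1)
  have hinj (i j : Fin H.natDegree) (hij : i ≠ j) : π (c i) ≠ π (c j) := by
    rcases lt_or_gt_of_ne hij with hlt | hlt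
    · have := hne i (j - i) (by omega) (by omega)
      rwa [Nat.add_sub_cancel' (by omega)] at this
    · have := hne j (i - j) (by omega) (by omega)
      rw [Nat.add_sub_cancel' (by omega)] at this
      exact this.symm
  have hbinj : Function.Injective (fun i : Fin H.natDegree => c i) := fun i j hij => by
    by_contra hn
    exact hinj i j hn (congrArg π hij)
  have hmonic : (H.map (Int.castRingHom W)).Monic := hH.map _
  have hprod : H.map (Int.castRingHom W) = ∏ i : Fin H.natDegree, (X - C (c i)) := by
    refine eq_of_monic_of_dvd_of_natDegree_le (monic_prod_of_monic _ _ fun i _ => monic_X_sub_C _)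
      hmonic ?_ (by simp [hH.natDegree_map])
    have hle : Finset.univ.val.map (fun i : Fin H.natDegree => c i) ≤
        (H.map (Int.castRingHom W)).roots := by
      rw [Multiset.le_iff_subset (Finset.univ.nodup.map hbinj)]
      intro x hx
      obtain ⟨i, _, rfl⟩ := Multiset.mem_map.1 hx
      rw [mem_roots hmonic.ne_zero, IsRoot, eval_map]
      exact hcroot i
    have hdvd := (Multiset.prod_X_sub_C_dvd_iff_le_roots hmonic.ne_zero _).2 hle
    rwa [Multiset.map_map] at hdvd
  refine ⟨fun i => c i, fun i => ?_, fun i j hij => ?_, hprod⟩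
  · have hsucc : φ (c i) = c (i + 1) := (Function.iterate_succ_apply' φ i b₀).symm
    change φ (c i) = c (finRotate _ i)
    rw [hsucc]
    have : NeZero H.natDegree := i.neZero
    rw [finRotate_apply]
    rcases Nat.lt_or_ge (i + 1) H.natDegree with hlt | hge
    · rw [Fin.val_add_one_of_lt' hlt]
    · have hi : (i : ℕ) + 1 = H.natDegree := le_antisymm i.2 hge
      have hi0 : ((i + 1 : Fin H.natDegree) : ℕ) = 0 := by
        rw [Fin.val_add, Fin.val_one', Nat.add_mod_mod, hi, Nat.mod_self]
      rw [hi0, hi]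
      have hroot : (H.map (Int.castRingHom W)).eval (c H.natDegree) = 0 := by
        rw [eval_map]
        exact hcroot _
      rw [hprod, eval_prod, Finset.prod_eq_zero_iff] at hroot
      obtain ⟨j, _, hj⟩ := hroot
      rw [eval_sub, eval_X, eval_C, sub_eq_zero] at hj
      by_cases hj0 : (j : ℕ) = 0
      · rw [hj, hj0]
      · have := hne j (H.natDegree - j) (by omega) (by omega)
        rw [Nat.add_sub_cancel' j.2.le, hj] at this
        exact absurd rfl this
  · change ¬ (2 : W) ∣ c i - c j
    rw [hπ, map_sub, sub_eq_zero]
    exact hinj i j hij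

theorem not_irreducible_map_of_derivative_eq {H A M R : ℤ[X]} (hH : H.Monic)
    (hdvd : 4 ∣ H.natDegree) (hM : M.natDegree + 1 < H.natDegree)
    (hder : derivative H = A ^ 2 + 4 * M + 8 * R) :
    ¬ Irreducible (H.map (Int.castRingHom (ZMod 2))) := by
  intro hirr
  obtain ⟨b, hφ, hb, hprod⟩ := exists_frobenius_cycle_roots hH hirr
  have h2 : Prime (2 : WittVector 2 (AlgebraicClosure (ZMod 2))) := by
    exact_mod_cast (WittVector.irreducible 2 (k := AlgebraicClosure (ZMod 2))).prime
  exact not_derivative_eq_sq_add_of_frobenius_cycle h2 WittVector.frobenius hdvd b hφ hb H A M R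
    hprod hM hder

theorem derivative_comp_X_pow_four_add_X_pow_add_one {R : Type*} [CommRing R] (g : R[X]) (s : ℕ) :
    derivative (g.comp (X ^ 4) + X ^ s + 1) =
      4 * (X ^ 3 * (derivative g).comp (X ^ 4)) + (s : R[X]) * X ^ (s - 1) := by
  have h3 : (C 3 : R[X]) = 3 := map_ofNat C 3
  simp [derivative_comp, derivative_X_pow, h3]
  ring

theorem higher_weight_not_stable_two
    (d s : ℕ) (hd : 1 ≤ d)
    (g : Polynomial (ZMod 2)) (hgmonic : g.Monic) (hgdeg : g.natDegree = d)
    (hs1 : 1 ≤ s) (hs2 : s < 4 * d)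
    (f : Polynomial (ZMod 2))
    (hf : f = g.comp (X ^ 4) + X ^ s + 1) :
    ¬ (∀ k : ℕ, 1 ≤ k → Irreducible ((fun q => f.comp q)^[k] (X : Polynomial (ZMod 2)))) := by
  intro hstable
  have hirr : Irreducible (f.comp f) := by simpa using hstable 2 (by norm_num)
  rcases Nat.even_or_odd' s with ⟨r, rfl | rfl⟩
  · have hder : derivative f = 0 := by
      have h2 : (2 : (ZMod 2)[X]) = 0 := CharTwo.two_eq_zero
      rw [hf, derivative_comp_X_pow_four_add_X_pow_add_one, Nat.cast_mul, Nat.cast_ofNat,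
        show (4 : (ZMod 2)[X]) = 2 * 2 by norm_num, h2]
      ring
    have hsep := PerfectField.separable_of_irreducible hirr
    rw [Separable, derivative_comp, hder, zero_comp, mul_zero, isCoprime_zero_right] at hsep
    exact hirr.not_isUnit hsep
  · obtain ⟨G, hGg, hGdeg, hG⟩ := lifts_and_natDegree_eq_and_monic (f := Int.castRingHom (ZMod 2))
      (p := g) ((mem_lifts g).2 (map_surjective _ (ZMod.ringHom_surjective _) g)) hgmonic
    rw [hgdeg] at hGdeg
    set F : ℤ[X] := G.comp (X ^ 4) + X ^ (2 * r + 1) + 1 with hF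
    have hcompdeg : (G.comp (X ^ 4)).natDegree = 4 * d := by
      rw [natDegree_comp, hGdeg, natDegree_X_pow, mul_comm]
    have hlow : (X ^ (2 * r + 1) + 1 : ℤ[X]).natDegree < (G.comp (X ^ 4)).natDegree := by
      rw [hcompdeg, ← C_1, natDegree_X_pow_add_C]
      exact hs2
    have hFdeg : F.natDegree = 4 * d := by
      rw [hF, add_assoc, natDegree_add_eq_left_of_natDegree_lt hlow, hcompdeg]
    have hFmonic : F.Monic := by
      rw [hF, add_assoc]
      exact (hG.comp (monic_X_pow 4) (by simp)).add_of_left (degree_lt_degree hlow)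
    have hFf : F.map (Int.castRingHom (ZMod 2)) = f := by
      simp [hF, hf, Polynomial.map_comp, hGg]
    have hHdeg : (F.comp F).natDegree = 4 * d * (4 * d) := by rw [natDegree_comp, hFdeg]
    set q : ℤ[X] := X ^ 3 * (derivative G).comp (X ^ 4) with hq
    have hqdeg : q.natDegree ≤ 4 * d - 1 := by
      refine natDegree_mul_le.trans ?_
      rw [natDegree_comp, natDegree_X_pow, natDegree_X_pow]
      have := natDegree_derivative_le G
      omega
    have hFder : derivative F = 4 * q + ((2 * r + 1 : ℕ) : ℤ[X]) * X ^ (2 * r) :=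
      derivative_comp_X_pow_four_add_X_pow_add_one G (2 * r + 1)
    refine not_irreducible_map_of_derivative_eq (H := F.comp F)
      (A := ((2 * r + 1 : ℕ) : ℤ[X]) * X ^ r * F ^ r)
      (M := ((2 * r + 1 : ℕ) : ℤ[X]) * (q * F ^ (2 * r) + X ^ (2 * r) * q.comp F))
      (R := 2 * q * q.comp F)
      (hFmonic.comp hFmonic (by omega)) ?_ ?_ ?_ ?_
    · exact hHdeg ▸ ⟨d * (4 * d), by ring⟩
    · have h1 : (q * F ^ (2 * r)).natDegree ≤ 4 * d * (4 * d) - 2 := by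
        refine natDegree_mul_le.trans ?_
        rw [natDegree_pow, hFdeg]
        have : 2 * r * (4 * d) ≤ (4 * d - 2) * (4 * d) := Nat.mul_le_mul_right _ (by omega)
        rw [Nat.sub_mul] at this
        have : 2 * (4 * d) ≤ 4 * d * (4 * d) := Nat.mul_le_mul_right _ (by omega)
        omega
      have h2 : (X ^ (2 * r) * q.comp F).natDegree ≤ 4 * d * (4 * d) - 2 := by
        refine natDegree_mul_le.trans ?_
        rw [natDegree_comp, natDegree_X_pow, hFdeg]
        have : q.natDegree * (4 * d) ≤ (4 * d - 1) * (4 * d) := Nat.mul_le_mul_right _ hqdeg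
        rw [Nat.sub_mul, one_mul] at this
        have : 4 * d ≤ 4 * d * (4 * d) := Nat.le_mul_of_pos_left _ (by omega)
        omega
      have h3 := natDegree_add_le_of_degree_le h1 h2
      have h4 := (natDegree_mul_le (p := ((2 * r + 1 : ℕ) : ℤ[X]))
        (q := q * F ^ (2 * r) + X ^ (2 * r) * q.comp F))
      rw [natDegree_natCast, zero_add] at h4
      have : 4 * 4 ≤ 4 * d * (4 * d) := Nat.mul_le_mul (by omega) (by omega)
      rw [hHdeg]
      omega
    · rw [derivative_comp, hFder]
      simp only [add_comp, mul_comp, pow_comp, X_comp, natCast_comp, ofNat_comp]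
      ring
    · rwa [Polynomial.map_comp, hFf]
end

section
/- Let n ≥ 1, let s be an integer with 0 < s < 2n, let c ∈ ℂ, and let β_1, ..., β_(2n) be the roots (with multiplicity) of the polynomial x^(2n) + x^(2n−s) + c in ℂ. If s ≠ n, then the power sum β_1^(2s) + β_2^(2s) + ... + β_(2n)^(2s) equals s; if s = n, then β_1^(2n) + β_2^(2n) + ... + β_(2n)^(2n) equals n − 2n·c. -/
open Polynomial Finset

/-- Newton's identities for the power sums of a finite family, in terms of the coefficients of the
monic polynomial having that family as its roots. -/
theorem mul_signed_esymm_eq_neg_sum {σ R : Type*} [Fintype σ] [CommRing R] (β : σ → R) (k : ℕ) :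
    (k : R) * ((-1) ^ k * (univ.val.map β).esymm k) =
      -∑ i ∈ range k, ((-1) ^ i * (univ.val.map β).esymm i) * ∑ j, β j ^ (k - i) := by
  classical
  have h := congrArg (MvPolynomial.aeval β) (MvPolynomial.mul_esymm_eq_sum σ R k)
  simp only [map_mul, map_natCast, map_pow, map_neg, map_one, map_sum,
    MvPolynomial.aeval_esymm_eq_multiset_esymm, MvPolynomial.psum, MvPolynomial.aeval_X] at h
  rw [sum_filter, Nat.sum_antidiagonal_eq_sum_range_succ_mk, sum_range_succ] at h
  simp only [lt_irrefl, if_false, add_zero] at h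
  rw [sum_congr rfl fun i hi => if_pos (mem_range.mp hi)] at h
  rw [mul_left_comm, h, ← mul_assoc, ← pow_add, (by ring : k + (k + 1) = 2 * k + 1), pow_succ,
    pow_mul]
  simp

theorem signed_esymm_eq_coeff {σ R : Type*} [Fintype σ] [CommRing R] (β : σ → R) {k : ℕ}
    (hk : k ≤ Fintype.card σ) :
    (-1) ^ k * (univ.val.map β).esymm k = (∏ i, (X - C (β i))).coeff (Fintype.card σ - k) := by
  have h := Multiset.prod_X_sub_C_coeff (univ.val.map β) (k := Fintype.card σ - k) (by simp)
  simp only [Multiset.map_map, Function.comp_def, Multiset.card_map, card_val, card_univ,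
    Nat.sub_sub_self hk] at h
  exact h.symm

theorem power_sum_two_s_of_trinomial_roots
    (n s : ℕ) (hn : 1 ≤ n) (hs : 0 < s) (hs2 : s < 2 * n)
    (c : ℂ) (β : Fin (2 * n) → ℂ)
    (hβ : (X ^ (2 * n) + X ^ (2 * n - s) + C c : Polynomial ℂ)
      = ∏ i, (X - C (β i))) :
    (s ≠ n → ∑ i, β i ^ (2 * s) = (s : ℂ)) ∧
      (s = n → ∑ i, β i ^ (2 * n) = (n : ℂ) - 2 * (n : ℂ) * c) := by
  have hq (k : ℕ) : (-1) ^ k * (univ.val.map β).esymm k =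
      (if k = 0 then 1 else 0) + (if k = s then 1 else 0) + (if k = 2 * n then c else 0) := by
    rcases le_or_gt k (2 * n) with hk | hk
    · rw [signed_esymm_eq_coeff β (by simpa using hk), ← hβ, Fintype.card_fin]
      simp only [coeff_add, coeff_X_pow, coeff_C]
      congr 1
      · congr 1 <;> exact if_congr (by omega) rfl rfl
      · exact if_congr (by omega) rfl rfl
    · rw [if_neg (by omega), if_neg (by omega), if_neg (by omega), Multiset.esymm,
        Multiset.powersetCard_eq_empty _ (by simpa using hk)]
      simp
  have newton (k : ℕ) (hk : 0 < k) :
      (k : ℂ) * ((if k = s then 1 else 0) + (if k = 2 * n then c else 0)) =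
        -(∑ j, β j ^ k + (if s < k then ∑ j, β j ^ (k - s) else 0) +
          (if 2 * n < k then c * ∑ j, β j ^ (k - 2 * n) else 0)) := by
    have h := mul_signed_esymm_eq_neg_sum β k
    simp only [hq, add_mul, ite_mul, one_mul, zero_mul, sum_add_distrib, sum_ite_eq', mem_range,
      if_pos hk, if_neg hk.ne', zero_add, Nat.sub_zero] at h
    exact h
  have h_s : ∑ j, β j ^ s = -(s : ℂ) := by
    have h := newton s hs
    rw [if_pos rfl, if_neg hs2.ne, if_neg (lt_irrefl s), if_neg hs2.not_gt] at h
    linear_combination h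
  constructor
  · intro hne
    have h := newton (2 * s) (by omega)
    rw [if_neg (by omega), if_neg (by omega), if_pos (by omega), (by omega : 2 * s - s = s),
      h_s] at h
    rcases lt_or_gt_of_ne hne with hlt | hgt
    · rw [if_neg (by omega)] at h
      linear_combination h
    · have h' := newton (2 * s - 2 * n) (by omega)
      rw [if_neg (by omega), if_neg (by omega), if_neg (by omega), if_neg (by omega)] at h'
      rw [if_pos (by omega)] at h
      linear_combination h - c * h'
  · rintro rfl
    have h := newton (2 * s) (by omega)
    rw [if_neg (by omega), if_pos rfl, if_pos hs2, if_neg (lt_irrefl _),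
      (by omega : 2 * s - s = s), h_s] at h
    push_cast at h
    linear_combination h
end

section
/- Let n ≥ 1, let s be an integer with 0 < s < 2n and s ≠ n, let c ∈ ℂ, and let β_1, ..., β_(2n) be the roots (with multiplicity) of the polynomial x^(2n) + x^(2n−s) + c in ℂ. Then the second elementary symmetric polynomial of the s-th powers of the roots, Σ_{1 ≤ i < j ≤ 2n} β_i^s · β_j^s, equals (s^2 − s)/2. -/
open Polynomial Finset

/-- **Newton's identities** for the roots `β` of a monic polynomial, expressing the power sums
through the signed elementary symmetric functions, that is, through the coefficients. -/
theorem sum_pow_eq_neg_mul_esymm_sub_sum {σ R : Type*} [Fintype σ] [CommRing R] (β : σ → R)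
    {k : ℕ} (hk : 0 < k) :
    ∑ i, β i ^ k = -(k * ((-1) ^ k * (univ.val.map β).esymm k))
      - ∑ j ∈ Ioo 0 k, (-1) ^ j * (univ.val.map β).esymm j * ∑ i, β i ^ (k - j) := by
  have h := congrArg (MvPolynomial.aeval β) (MvPolynomial.psum_eq_mul_esymm_sub_sum σ R k hk)
  simp only [MvPolynomial.psum, map_sub, map_mul, map_sum, map_pow, map_neg, map_one, map_natCast,
    MvPolynomial.aeval_X, MvPolynomial.aeval_esymm_eq_multiset_esymm] at h
  rw [h, sum_filter, Nat.sum_antidiagonal_eq_sum_range_succ_mk, ← sum_filter]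
  congr 1
  · ring
  · refine sum_congr ?_ fun _ _ => rfl
    ext j
    simp only [mem_filter, mem_range, Set.mem_Ioo, mem_Ioo]
    omega

theorem neg_one_pow_mul_esymm_eq_coeff {R : Type*} [CommRing R] {N : ℕ} (β : Fin N → R)
    {k : ℕ} (hk : k ≤ N) :
    (-1) ^ k * (univ.val.map β).esymm k = (∏ i, (X - C (β i))).coeff (N - k) := by
  have h := Multiset.prod_X_sub_C_coeff (univ.val.map β) (k := N - k) (by simp)
  rw [Multiset.map_map] at h
  simpa [Nat.sub_sub_self hk, List.prod_ofFn] using h.symm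

theorem esymm_eq_zero_of_card_lt {R : Type*} [CommSemiring R] {s : Multiset R} {k : ℕ}
    (hk : Multiset.card s < k) : s.esymm k = 0 := by
  rw [Multiset.esymm, Multiset.powersetCard_eq_empty k hk]
  simp

theorem neg_one_pow_mul_esymm_of_trinomial {R : Type*} [CommRing R] {N s : ℕ} (hs2 : s < N) (c : R)
    (β : Fin N → R) (hβ : X ^ N + X ^ (N - s) + C c = ∏ i, (X - C (β i))) {k : ℕ} (hk : 0 < k) :
    (-1) ^ k * (univ.val.map β).esymm k = (if k = s then 1 else 0) + if k = N then c else 0 := by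
  rcases le_or_gt k N with hkN | hkN
  · rw [neg_one_pow_mul_esymm_eq_coeff β hkN, ← hβ, coeff_add, coeff_add, coeff_X_pow, coeff_X_pow,
      coeff_C, if_neg (by omega), zero_add]
    congr 1 <;> exact if_congr (by omega) rfl rfl
  · rw [esymm_eq_zero_of_card_lt (by simpa using hkN), if_neg (by omega), if_neg (by omega)]
    simp

theorem two_mul_sum_sum_Ioi_mul {ι R : Type*} [Fintype ι] [LinearOrder ι] [LocallyFiniteOrder ι]
    [LocallyFiniteOrderTop ι] [LocallyFiniteOrderBot ι] [CommRing R] (x : ι → R) :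
    2 * ∑ i, ∑ j ∈ Ioi i, x i * x j = (∑ i, x i) ^ 2 - ∑ i, x i ^ 2 := by
  have h := sum_sum_Ioi_add_eq_sum_sum_off_diag fun i j => x i * x j
  have hcompl (i : ι) : ∑ j ∈ {i}ᶜ, x j * x i = (∑ j, x j) * x i - x i ^ 2 := by
    rw [sum_mul, ← sum_compl_add_sum {i}]
    simp [sq]
  simp only [hcompl, sum_sub_distrib, ← mul_sum, ← sq] at h
  rw [← h, mul_sum]
  refine sum_congr rfl fun i _ => ?_
  rw [mul_sum]
  exact sum_congr rfl fun j _ => by ring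

theorem elementary_symmetric_two_of_s_powers_of_trinomial_roots
    (n s : ℕ) (hn : 1 ≤ n) (hs : 0 < s) (hs2 : s < 2 * n) (hsn : s ≠ n)
    (c : ℂ) (β : Fin (2 * n) → ℂ)
    (hβ : (X ^ (2 * n) + X ^ (2 * n - s) + C c : Polynomial ℂ)
      = ∏ i, (X - C (β i))) :
    ∑ i, ∑ j ∈ Finset.Ioi i, β i ^ s * β j ^ s = ((s : ℂ) ^ 2 - s) / 2 := by
  have newton {k : ℕ} (hk : 0 < k) :
      ∑ i, β i ^ k = -(k * ((if k = s then 1 else 0) + if k = 2 * n then c else 0))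
        - ∑ j ∈ Ioo 0 k, ((if j = s then 1 else 0) + if j = 2 * n then c else 0)
          * ∑ i, β i ^ (k - j) := by
    rw [sum_pow_eq_neg_mul_esymm_sub_sum β hk, neg_one_pow_mul_esymm_of_trinomial hs2 c β hβ hk]
    congr 1
    refine sum_congr rfl fun j hj => ?_
    rw [neg_one_pow_mul_esymm_of_trinomial hs2 c β hβ (mem_Ioo.mp hj).1]
  simp only [add_mul, ite_mul, one_mul, zero_mul, sum_add_distrib, sum_ite_eq', mem_Ioo] at newton
  have sum_pow_of_lt {k : ℕ} (hk : 0 < k) (hks : k < s) : ∑ i, β i ^ k = 0 := by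
    rw [newton hk, if_neg (by omega), if_neg (by omega), if_neg (by omega), if_neg (by omega)]
    simp
  have sum_pow_s : ∑ i, β i ^ s = -s := by
    rw [newton hs, if_pos rfl, if_neg (by omega), if_neg (by omega), if_neg (by omega)]
    simp
  have sum_pow_two_mul_s : ∑ i, β i ^ (2 * s) = s := by
    rw [newton (by omega), if_neg (by omega), if_neg (by omega), if_pos (by omega),
      show 2 * s - s = s by omega, sum_pow_s]
    split_ifs with h
    · rw [sum_pow_of_lt (by omega) (by omega)]
      simp
    · simp
  have h := two_mul_sum_sum_Ioi_mul fun i => β i ^ s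
  simp only [← pow_mul, mul_comm s 2, sum_pow_s, sum_pow_two_mul_s] at h
  linear_combination h / 2
end

section
/- Let f(x) = x^10 + x^9 + x^6 + x^5 + x^4 + x^3 + 1 ∈ F_2[x]. Then f, f^(2) = f ∘ f, and f^(3) = f ∘ f ∘ f are irreducible over F_2, but f^(4) = f ∘ f ∘ f ∘ f is reducible over F_2. -/
open Polynomial

/-! ### Packed arithmetic

A polynomial over `ZMod 2` is packed into a natural number by evaluating a lift with small natural
coefficients at `2 ^ 16`, so that ring operations become operations on natural numbers. -/

/-- `N` is the value at `2 ^ 16` of a lift of `p` of degree at most `d` with coefficients at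
most `c`. -/
def Packs (c d N : ℕ) (p : (ZMod 2)[X]) : Prop :=
  ∃ P : ℕ[X], P.eval (2 ^ 16) = N ∧ (∀ i, P.coeff i ≤ c) ∧ P.natDegree ≤ d ∧
    P.map (Nat.castRingHom (ZMod 2)) = p

/-- The packed polynomial all of whose coefficients up to degree `d` are one. -/
def ones (d : ℕ) : ℕ := ((2 ^ 16) ^ (d + 1) - 1) / (2 ^ 16 - 1)

theorem ones_eq_sum (d : ℕ) : ones d = ∑ i ∈ Finset.range (d + 1), (2 ^ 16) ^ i :=
  (Nat.geomSum_eq (by norm_num) _).symm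

theorem eval_eq_divX (P : ℕ[X]) (b : ℕ) : P.eval b = P.divX.eval b * b + P.coeff 0 := by
  conv_lhs => rw [← divX_mul_X_add P]
  simp

theorem testBit_eval (P : ℕ[X]) (hP : ∀ i, P.coeff i < 2 ^ 16) (i : ℕ) :
    (P.eval (2 ^ 16)).testBit (16 * i) = decide (P.coeff i % 2 = 1) := by
  induction i generalizing P with
  | zero =>
    rw [eval_eq_divX, mul_zero, Nat.testBit_zero]
    congr 2
    omega
  | succ i ih =>
    have h : P.eval (2 ^ 16) / 2 ^ 16 = P.divX.eval (2 ^ 16) := by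
      rw [eval_eq_divX P]
      have := hP 0
      omega
    rw [mul_add, mul_one, ← Nat.testBit_div_two_pow, h,
      ih _ fun j => by rw [coeff_divX]; exact hP _, coeff_divX]

theorem exists_eval_eq (N : ℕ) : ∃ P : ℕ[X], (∀ i, P.coeff i < 2 ^ 16) ∧ P.eval (2 ^ 16) = N := by
  induction N using Nat.strong_induction_on with
  | _ N ih =>
    rcases Nat.eq_zero_or_pos N with rfl | hN
    · exact ⟨0, by simp, by simp⟩
    · obtain ⟨P, hP, he⟩ := ih (N / 2 ^ 16) (Nat.div_lt_self hN (by norm_num))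
      refine ⟨P * X + C (N % 2 ^ 16), fun i => ?_, ?_⟩
      · cases i with
        | zero => simpa using Nat.mod_lt N (by norm_num)
        | succ i => simpa [coeff_C] using hP i
      · rw [eval_add, eval_mul, eval_X, eval_C, he]
        omega

theorem land_mul_add (a b c : ℕ) (hc : c < 2 ^ 16) :
    (a * 2 ^ 16 + c) &&& (b * 2 ^ 16 + 1) = (a &&& b) * 2 ^ 16 + c % 2 := by
  have hd : ((a * 2 ^ 16 + c) &&& (b * 2 ^ 16 + 1)) / 2 ^ 16 = a &&& b := by
    rw [Nat.and_div_two_pow]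
    congr 1 <;> omega
  have hm : ((a * 2 ^ 16 + c) &&& (b * 2 ^ 16 + 1)) % 2 ^ 16 = c % 2 := by
    rw [Nat.and_mod_two_pow, show (a * 2 ^ 16 + c) % 2 ^ 16 = c by omega,
      show (b * 2 ^ 16 + 1) % 2 ^ 16 = 1 by omega, Nat.and_one_is_mod]
  omega

theorem eval_land_sum (P : ℕ[X]) (hP : ∀ i, P.coeff i < 2 ^ 16) (n : ℕ) :
    P.eval (2 ^ 16) &&& ∑ i ∈ Finset.range n, (2 ^ 16) ^ i =
      ∑ i ∈ Finset.range n, P.coeff i % 2 * (2 ^ 16) ^ i := by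
  induction n generalizing P with
  | zero => simp
  | succ n ih =>
    have h := ih P.divX fun j => by rw [coeff_divX]; exact hP _
    rw [Finset.sum_range_succ', Finset.sum_range_succ']
    have hpow : ∀ j, (2 ^ 16) ^ (j + 1) = (2 ^ 16) ^ j * 2 ^ 16 := fun j => pow_succ _ _
    simp only [hpow, pow_zero, ← mul_assoc, ← Finset.sum_mul, mul_one]
    rw [eval_eq_divX P, land_mul_add _ _ _ (hP 0), h]
    simp only [coeff_divX]

theorem Packs.coeff_eq {c d N : ℕ} {p : (ZMod 2)[X]} (h : Packs c d N p) (hc : c < 2 ^ 16) (i : ℕ) :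
    p.coeff i = if N.testBit (16 * i) then 1 else 0 := by
  obtain ⟨P, rfl, hP, -, rfl⟩ := h
  rw [testBit_eval P fun i => (hP i).trans_lt hc, coeff_map, eq_natCast]
  rcases Nat.mod_two_eq_zero_or_one (P.coeff i) with h | h
  · simpa [h] using (ZMod.natCast_eq_zero_iff _ 2).2 (Nat.dvd_of_mod_eq_zero h)
  · rw [← ZMod.natCast_mod, h]
    simp

theorem Packs.unique {c c' d d' N : ℕ} {p q : (ZMod 2)[X]} (hp : Packs c d N p)
    (hq : Packs c' d' N q) (hc : c < 2 ^ 16) (hc' : c' < 2 ^ 16) : p = q := by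
  ext i
  rw [hp.coeff_eq hc, hq.coeff_eq hc']

theorem Packs.mono {c c' d d' N : ℕ} {p : (ZMod 2)[X]} (h : Packs c d N p) (hc : c ≤ c')
    (hd : d ≤ d') : Packs c' d' N p := by
  obtain ⟨P, h₁, h₂, h₃, h₄⟩ := h
  exact ⟨P, h₁, fun i => (h₂ i).trans hc, h₃.trans hd, h₄⟩

theorem packs_one : Packs 1 0 1 1 :=
  ⟨1, by simp, fun i => by rw [coeff_one]; split <;> simp, by simp, by simp⟩

theorem packs_X : Packs 1 1 (2 ^ 16) X :=
  ⟨X, by simp, fun i => by rw [coeff_X]; split <;> simp, by simp, by simp⟩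

theorem Packs.add {c c' d d' N M : ℕ} {p q : (ZMod 2)[X]} (hp : Packs c d N p)
    (hq : Packs c' d' M q) : Packs (c + c') (max d d') (N + M) (p + q) := by
  obtain ⟨P, rfl, hP, hPd, rfl⟩ := hp
  obtain ⟨Q, rfl, hQ, hQd, rfl⟩ := hq
  refine ⟨P + Q, by simp, fun i => ?_, ?_, by simp⟩
  · rw [coeff_add]
    exact add_le_add (hP i) (hQ i)
  · exact (natDegree_add_le P Q).trans (max_le_max hPd hQd)

theorem Packs.mul {c c' d d' N M : ℕ} {p q : (ZMod 2)[X]} (hp : Packs c d N p)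
    (hq : Packs c' d' M q) : Packs ((d + 1) * (c * c')) (d + d') (N * M) (p * q) := by
  obtain ⟨P, rfl, hP, hPd, rfl⟩ := hp
  obtain ⟨Q, rfl, hQ, hQd, rfl⟩ := hq
  refine ⟨P * Q, by simp, fun i => ?_, natDegree_mul_le.trans (add_le_add hPd hQd), by simp⟩
  rw [coeff_mul, Finset.Nat.sum_antidiagonal_eq_sum_range_succ_mk]
  calc ∑ k ∈ Finset.range (i + 1), P.coeff k * Q.coeff (i - k)
      ≤ ∑ k ∈ Finset.range (d + 1), P.coeff k * Q.coeff (i - k) :=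
        Finset.sum_le_sum_of_ne_zero fun k _ hk => Finset.mem_range_succ_iff.2
          ((le_natDegree_of_ne_zero (left_ne_zero_of_mul hk)).trans hPd)
    _ ≤ (d + 1) * (c * c') := by
        simpa using Finset.sum_le_card_nsmul (Finset.range (d + 1)) _ (c * c')
          fun k _ => Nat.mul_le_mul (hP k) (hQ (i - k))

theorem Packs.land {c d N D : ℕ} {p : (ZMod 2)[X]} (h : Packs c d N p) (hc : c < 2 ^ 16)
    (hd : d ≤ D) : Packs 1 d (N &&& ones D) p := by
  obtain ⟨P, rfl, hP, hPd, rfl⟩ := h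
  have hP' : ∀ i, P.coeff i < 2 ^ 16 := fun i => (hP i).trans_lt hc
  have key : ∀ j, (∑ i ∈ Finset.range (D + 1), monomial i (P.coeff i % 2)).coeff j =
      P.coeff j % 2 := by
    intro j
    simp only [finsetSum_coeff, coeff_monomial, Finset.sum_ite_eq', Finset.mem_range]
    split_ifs with hj
    · rfl
    · rw [coeff_eq_zero_of_natDegree_lt (by omega), Nat.zero_mod]
  refine ⟨∑ i ∈ Finset.range (D + 1), monomial i (P.coeff i % 2), ?_, fun i => ?_, ?_, ?_⟩
  · rw [ones_eq_sum, eval_land_sum P hP', eval_finsetSum]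
    simp only [eval_monomial]
  · rw [key]
    omega
  · rw [natDegree_le_iff_coeff_eq_zero]
    intro j hj
    rw [key, coeff_eq_zero_of_natDegree_lt (by omega), Nat.zero_mod]
  · ext j
    rw [coeff_map, coeff_map, key, eq_natCast, eq_natCast, ZMod.natCast_mod]

theorem exists_packs_land (N D : ℕ) : ∃ p, Packs 1 D (N &&& ones D) p := by
  obtain ⟨P, hP, rfl⟩ := exists_eval_eq N
  have key : ∀ j, (∑ i ∈ Finset.range (D + 1), monomial i (P.coeff i % 2)).coeff j =
      if j < D + 1 then P.coeff j % 2 else 0 := by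
    intro j
    simp only [finsetSum_coeff, coeff_monomial, Finset.sum_ite_eq', Finset.mem_range]
  refine ⟨_, ∑ i ∈ Finset.range (D + 1), monomial i (P.coeff i % 2), ?_, fun i => ?_, ?_, rfl⟩
  · rw [ones_eq_sum, eval_land_sum P hP, eval_finsetSum]
    simp only [eval_monomial]
  · rw [key]
    split_ifs <;> omega
  · rw [natDegree_le_iff_coeff_eq_zero]
    intro j hj
    rw [key, if_neg (by omega)]

theorem coeff_mul_pow_le_eval (P : ℕ[X]) (b i : ℕ) : P.coeff i * b ^ i ≤ P.eval b := by
  by_cases h : P.coeff i = 0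
  · simp [h]
  · rw [eval_eq_sum, sum_def]
    exact Finset.single_le_sum (f := fun j => P.coeff j * b ^ j) (fun _ _ => Nat.zero_le _)
      (mem_support_iff.2 h)

theorem Packs.of_lt {c d D N : ℕ} {p : (ZMod 2)[X]} (h : Packs c d N p)
    (hN : N < (2 ^ 16) ^ (D + 1)) : Packs c D N p := by
  obtain ⟨P, rfl, hP, -, hp⟩ := h
  refine ⟨P, rfl, hP, natDegree_le_iff_coeff_eq_zero.2 fun i hi => ?_, hp⟩
  by_contra h
  have h₁ := coeff_mul_pow_le_eval P (2 ^ 16) i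
  have h₂ : (2 ^ 16) ^ (D + 1) ≤ (2 ^ 16) ^ i := Nat.pow_le_pow_right (by norm_num) hi
  have h₃ : (2 ^ 16) ^ i ≤ P.coeff i * (2 ^ 16) ^ i := Nat.le_mul_of_pos_left _ (by omega)
  exact absurd hN (not_lt.2 (h₂.trans (h₃.trans h₁)))

/-! ### Kernel computations on packed polynomials -/

/-- `f n`, arranged so that the kernel evaluates `n` before substituting it into `f`. -/
def force {α : Type} (n : ℕ) (f : ℕ → α) : α :=
  Nat.rec (f 0) (fun m _ => f (Nat.succ m)) n

theorem force_eq {α : Type} (n : ℕ) (f : ℕ → α) : force n f = f n := by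
  cases n <;> rfl

/-- Moves the bits of `n`, in blocks of `2 ^ k`, to the positions divisible by 16. -/
def spread (k n : ℕ) : ℕ :=
  Nat.rec (fun n => n)
    (fun k ih n =>
      force ((n ||| n <<< (15 * 2 ^ k)) &&&
        (((2 ^ (2 ^ 18) - 1) / (2 ^ (16 * 2 ^ k) - 1)) * (2 ^ 2 ^ k - 1))) ih) k n

/-- A candidate for the packed square of `s` modulo the packed polynomial `F` of degree `n`, by
Barrett reduction with `μ` the packed quotient of `X ^ (2 * n)` by `F`. -/
def sqMod (n F μ s : ℕ) : ℕ :=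
  force (s * s) fun t =>
    (t + (((((t &&& ones (2 * n)) >>> (16 * n)) * μ) >>> (16 * n)) &&& ones n) * F) &&&
      ones (2 * n)

/-- Checks that `k` squarings modulo `F` take `s` to `t`. -/
def checkFrob (n F μ k : ℕ) : ℕ → ℕ → Bool :=
  Nat.rec (fun s t => Nat.beq s t)
    (fun _ ih s t =>
      force (sqMod n F μ s) fun r => bif Nat.blt r ((2 ^ 16) ^ (n + 1)) then ih r t else false) k

theorem Packs.sqMod {n F s : ℕ} {f p : (ZMod 2)[X]} (hn : n < 2 ^ 14) (μ : ℕ)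
    (hF : Packs 1 n F f) (hs : Packs 1 n s p) :
    ∃ r, Packs 1 (2 * n) (sqMod n F μ s) r ∧ f ∣ p ^ 2 - r := by
  rw [_root_.sqMod, force_eq]
  obtain ⟨q, hq⟩ := exists_packs_land
    ((((s * s) &&& ones (2 * n)) >>> (16 * n) * μ) >>> (16 * n)) n
  have h := ((hs.mul hs).add (hq.mul hF)).land (D := 2 * n) (by omega) (by omega)
  refine ⟨_, h.mono le_rfl (by omega), -q, by ring⟩

theorem dvd_of_checkFrob {n F μ k : ℕ} {f : (ZMod 2)[X]} (hn : n < 2 ^ 14) (hF : Packs 1 n F f)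
    {s t : ℕ} {p : (ZMod 2)[X]} (hs : Packs 1 n s p) (h : checkFrob n F μ k s t = true) :
    ∃ r, Packs 1 n t r ∧ f ∣ p ^ 2 ^ k - r := by
  induction k generalizing s p with
  | zero =>
    obtain rfl : s = t := Nat.eq_of_beq_eq_true h
    exact ⟨p, hs, by simp⟩
  | succ k ih =>
    change (force (sqMod n F μ s) fun r =>
      bif Nat.blt r ((2 ^ 16) ^ (n + 1)) then checkFrob n F μ k r t else false) = true at h
    rw [force_eq, Bool.cond_false_right, Bool.and_eq_true] at h
    obtain ⟨r, hr, hd⟩ := Packs.sqMod hn μ hF hs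
    obtain ⟨r', hr', hd'⟩ := ih (hr.of_lt (Nat.le_of_ble_eq_true h.1)) h.2
    refine ⟨r', hr', ?_⟩
    have h₁ : f ∣ (p ^ 2) ^ 2 ^ k - r ^ 2 ^ k := hd.trans (sub_dvd_pow_sub_pow _ _ _)
    rw [pow_succ' 2 k, pow_mul]
    simpa using dvd_add h₁ hd'

/-- Checks that `u * (h - X) + v * F = 1` for packed polynomials. -/
def checkBezout (n F h u v : ℕ) : Bool :=
  Nat.beq (((u &&& ones n) * h + (u &&& ones n) * 2 ^ 16 + (v &&& ones n) * F) &&& ones (2 * n)) 1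

theorem isCoprime_of_checkBezout {n F h u v : ℕ} {f p : (ZMod 2)[X]} (hn : n < 2 ^ 14)
    (h0 : 0 < n) (hF : Packs 1 n F f) (hp : Packs 1 n h p) (hc : checkBezout n F h u v = true) :
    IsCoprime f (p - X) := by
  obtain ⟨a, ha⟩ := exists_packs_land u n
  obtain ⟨b, hb⟩ := exists_packs_land v n
  have key := (((ha.mul hp).add (ha.mul packs_X)).add (hb.mul hF)).land (D := 2 * n)
    (by omega) (by omega)
  rw [Nat.eq_of_beq_eq_true hc] at key
  refine ⟨b, a, ?_⟩
  rw [← key.unique packs_one (by norm_num) (by norm_num), CharTwo.sub_eq_add]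
  ring

/-- The packed composition of the polynomial of the theorem with a packed polynomial `s`, of total
degree at most `d`. -/
def packedComp (d s : ℕ) : ℕ :=
  force s fun s => force (s * s &&& ones d) fun s2 => force (s2 * s &&& ones d) fun s3 =>
    force (s2 * s2 &&& ones d) fun s4 => force (s4 * s &&& ones d) fun s5 =>
      (((s5 * s5 &&& ones d) + (s5 * s4 &&& ones d) + (s3 * s3 &&& ones d) + s5 + s4 + s3 + 1) &&&
        ones d)

theorem Packs.packedComp {d s : ℕ} {p : (ZMod 2)[X]} (hd : d ≤ 1000) (hs : Packs 1 d s p) :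
    Packs 1 (10 * d) (packedComp (10 * d) s)
      ((X ^ 10 + X ^ 9 + X ^ 6 + X ^ 5 + X ^ 4 + X ^ 3 + 1 : (ZMod 2)[X]).comp p) := by
  simp only [_root_.packedComp, force_eq]
  have h2 := (hs.mul hs).land (D := 10 * d) (by omega) (by omega)
  have h3 := (h2.mul hs).land (D := 10 * d) (by omega) (by omega)
  have h4 := (h2.mul h2).land (D := 10 * d) (by omega) (by omega)
  have h5 := (h4.mul hs).land (D := 10 * d) (by omega) (by omega)
  have h6 := (h3.mul h3).land (D := 10 * d) (by omega) (by omega)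
  have h9 := (h5.mul h4).land (D := 10 * d) (by omega) (by omega)
  have h10 := (h5.mul h5).land (D := 10 * d) (by omega) (by omega)
  have h := ((((((h10.add h9).add h6).add h5).add h4).add h3).add packs_one).land (D := 10 * d)
    (by omega) (by omega)
  convert h.mono le_rfl (show _ ≤ 10 * d by omega) using 1
  simp only [add_comp, X_pow_comp, one_comp]
  ring

/-- The packed third iterate. -/
def packedIter3 : ℕ := packedComp 1000 (packedComp 100 (packedComp 10 (2 ^ 16)))

/-! ### The irreducibility test -/

/-- Rabin's irreducibility test over a finite field. -/
theorem irreducible_of_rabin {k : Type*} [Field k] [Finite k] {f : k[X]} (h0 : f.natDegree ≠ 0)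
    (hdvd : f ∣ X ^ Nat.card k ^ f.natDegree - X)
    (hcop : ∀ p : ℕ, p.Prime → p ∣ f.natDegree →
      IsCoprime f (X ^ Nat.card k ^ (f.natDegree / p) - X)) : Irreducible f := by
  have hf : f ≠ 0 := by rintro rfl; simp at h0
  obtain ⟨g, hg, hgf⟩ := exists_irreducible_of_natDegree_ne_zero h0
  have hd : g.natDegree ∣ f.natDegree :=
    hg.natDegree_dvd_of_dvd_X_pow_card_pow_sub_X (hgf.trans hdvd)
  obtain ⟨m, hm⟩ := hd
  have hm1 : m = 1 := by
    by_contra hm1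
    obtain ⟨p, hp, l, rfl⟩ := Nat.exists_prime_and_dvd hm1
    have hq : f.natDegree / p = g.natDegree * l := by
      rw [hm, mul_left_comm, Nat.mul_div_cancel_left _ hp.pos]
    have hgX : g ∣ X ^ Nat.card k ^ (f.natDegree / p) - X :=
      hg.natDegree_dvd_iff_dvd_X_pow_card_pow_sub_X.1 (hq ▸ dvd_mul_right _ _)
    exact hg.not_isUnit ((hcop p hp ⟨_, by rw [hm, mul_left_comm]⟩).isUnit_of_dvd' hgf hgX)
  rw [hm1, mul_one] at hm
  exact (associated_of_dvd_of_natDegree_le hgf hf hm.le).irreducible hg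

theorem Irreducible.of_polynomial_comp {k : Type*} [Field k] {f g : k[X]} (hg : g.natDegree ≠ 0)
    (h : Irreducible (f.comp g)) : Irreducible f := by
  have hu : ∀ a : k[X], IsUnit (a.comp g) → IsUnit a := by
    intro a ha
    have h0 := natDegree_eq_zero_of_isUnit ha
    rw [natDegree_comp, mul_eq_zero, or_iff_left hg] at h0
    rw [eq_C_of_natDegree_eq_zero h0, C_comp] at ha
    rwa [eq_C_of_natDegree_eq_zero h0]
  refine ⟨fun hf => h.not_isUnit ?_, fun a b hab => ?_⟩
  · exact hf.map (compRingHom g)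
  · rw [hab, mul_comp] at h
    exact (h.isUnit_or_isUnit rfl).imp (hu a) (hu b)

/-! ### Certificates -/

/-- The quotient of `X ^ 2000` by the third iterate, with its coefficients as bits. -/
def barrettLit : ℕ :=
  11429264196888928875554606005520431668573360196991023261654309165902737152468044521966612730675130844063585423322838388607734994963676011606203687389360227782898633649766457962447842658738321080716251803553829714348449428446834812890472616673551577514317455724453114768372196471228779258830416022569894

/-- The residue of `X ^ 2 ^ 200` modulo the third iterate, with its coefficients as bits. -/
def frob200Lit : ℕ :=
  3767668640255907649010238220635308688979166199557130677470854596466091161216158929682385164151717923572870836588893081944494710016065398432846040118619658148774960685698642437052521082122872277047683088872026548641881665352390846402251788630585881823551369748063771331762442368745176321370521648065158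

/-- The Bézout coefficient of `X ^ 2 ^ 200 - X`, with its coefficients as bits. -/
def bezoutLeft200Lit : ℕ :=
  3905667739103621121192980877474416828242897826149015578714577468115928832558823886777048592406554009808981682707257904528645430027241917504001038769202116047918379760619939932118114478920393020588661688844970295299612136365024910816037878014881124785043260395978179331588900648507735483221145727233610

/-- The Bézout coefficient of the third iterate, paired with `bezoutLeft200Lit`. -/
def bezoutRight200Lit : ℕ :=
  744836424281402006755633638944344962347191062603021061754078138598860253429177769564177763324933199917155988205309665361764300785839739929221244082655848826190183191053800470208290518061829124617626318139619827729492497562174657349220030845041034601254257723284991140693690601901956326364007612830673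

/-- The residue of `X ^ 2 ^ 500` modulo the third iterate, with its coefficients as bits. -/
def frob500Lit : ℕ :=
  9858656579031084366156264004057133649325167085018100464569679936022399150528236232089739327324186858028377997755911491527595601704444062992849663028032743188569743549286910015977426183454729727461611846711799244503093890029609447371468601914216181791995332328038054211402243712575488180485035950448405

/-- The Bézout coefficient of `X ^ 2 ^ 500 - X`, with its coefficients as bits. -/
def bezoutLeft500Lit : ℕ :=
  3996388164154258608879512069340965256664969059017466932202588123477828168896473899855304710169962838663535869686662299582861644151885061131052771395791414710104102088280381530056195320981494828491572016479273896601088468336765691409728057049174323951165022409112102791504413939210253893680879224206611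

/-- The Bézout coefficient of the third iterate, paired with `bezoutLeft500Lit`. -/
def bezoutRight500Lit : ℕ :=
  2116805770283003846382706312618034555209697670894774533226923938536710877092319353019560840024883440253971887538251703663258264767751936921236823784568102904326478081709607093122312537729778239494694473573528829286647917904893721566334585687477049779346571031841015184181333589359037231005357413688456

/-- A factor of degree 4000 of the fourth iterate, with its coefficients as bits. -/
def leftFactorLit : ℕ :=
  1880078539218905708413035076207331524304503211711706690971611790136472231870933309375764411386024764607079070628117219232512366975918457439372651213495393320495454162457284710427584032239235466544078056939057212269045844910608588413293455047375828607071202382595599774593419627370318956028216920579624918242580606345784068064089484893924996877308098449810090205846810177729773756743406305036750121441321296793343953814263312669918316794264659219779588676403195229258368880993708596658053078613055376112361744113912085495257143631501925516340492693282832205407635732277787224579491427701484372512665517155430036684952601752408501734083459743596478946447258366380319277685752184981652533786286716760935323484429907425127596117057018739874893134681189987675566397884276968657981509603618241203829822099115520125242128689717817762746578349088538291141814207928712287559244856595608227308131894554573318704608492623238124284304425701435617345840386102478384977249384861492778551557857174069959936321680751594364144876319790347174279021365213102595597254948958556294513755586053555545541452800201931004372956681558583949665152909831196421617000963688951051935120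4000724476718027340011947469391108615097571981661

/-- The cofactor of degree 6000 in the fourth iterate, with its coefficients as bits. -/
def rightFactorLit : ℕ :=
  2259137677100910575091541794124712207469069508102571500443078445452944248595009197831275380462118630945429138150578306818145148850380045874360344701859653353414119215225320935107548709203297700921301799366814542087638103777191931681118022476561197554928186041099460244960371963033942471446552442854849117459998024405690873155005790550745054850979629428983793496129603693512588829547815811106637533066222903000276903379662838794045875498084884113512211835131501912254422167402285638581115542344726742248138099656820948026319560008185084320708930225081376887087847630664064858657177897268212357100526956188906273920240139879507155804870687427697120650935016691363069869082658509164465877489358575311563579823874173175408962853718374131436456825012152946819903498332518111825493062385587814670834891921649228411815203224490345280503990311371645888350578235064269193520166793884342566863020749840183942142437647635106017957082106606131767924775749111103243052437740500829010460743412304167780538260658657277139675919810650722290862062779441563593469002150110426605380582660914077254686246131455996699149972370711905284384430471503421945490445772227797832430185102127866503570643290706312318485984608095543811576831575489829267707944765387293822792660014371831580922653237330037814689122313985176345243317908897994615611830650783093866050296315261396783422392694823411816243520582866904340849564301673279187558937882695958289223309712655948165754262117816354989527925328548136167010509206762823489068277333515723380106443390565786258118874063526083920133605357064406424932680758955154224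967287321220167436779965259973554639752132047521347437252946540002596313503201951848929331767678726494692485737793906250606074976159821651023223344925760118806635678886051150499627541493875711998792833007323227401697858193877

theorem checkFrob_iter3 :
    (force packedIter3 fun F => force (spread 14 barrettLit) fun μ =>
      force (spread 14 frob200Lit) fun s => force (spread 14 frob500Lit) fun t =>
        checkFrob 1000 F μ 200 (2 ^ 16) s && (checkFrob 1000 F μ 300 s t &&
          checkFrob 1000 F μ 500 t (2 ^ 16))) = true := by
  decide +kernel

theorem checkBezout_iter3 :
    (force packedIter3 fun F =>
      checkBezout 1000 F (spread 14 frob200Lit) (spread 14 bezoutLeft200Lit)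
        (spread 14 bezoutRight200Lit) &&
      checkBezout 1000 F (spread 14 frob500Lit) (spread 14 bezoutLeft500Lit)
        (spread 14 bezoutRight500Lit)) = true := by
  decide +kernel

theorem checkFactor_iter4 :
    (force (spread 14 leftFactorLit &&& ones 6000) fun G =>
      force (spread 14 rightFactorLit &&& ones 6000) fun H =>
        Nat.beq (G * H &&& ones 12000) (packedComp 10000 packedIter3) &&
          (G.testBit (16 * 4000) && H.testBit (16 * 6000))) = true := by
  decide +kernel

theorem irreducible_of_packs_iter3 {f : (ZMod 2)[X]} (hf : Packs 1 1000 packedIter3 f)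
    (hdeg : f.natDegree = 1000) : Irreducible f := by
  have h₁ := checkFrob_iter3
  have h₂ := checkBezout_iter3
  simp only [force_eq, Bool.and_eq_true] at h₁ h₂
  obtain ⟨r, hr, hfr⟩ := dvd_of_checkFrob (by norm_num) hf (packs_X.mono le_rfl (by norm_num)) h₁.1
  obtain ⟨s, hs, hfs⟩ := dvd_of_checkFrob (by norm_num) hf hr h₁.2.1
  obtain ⟨t, ht, hft⟩ := dvd_of_checkFrob (by norm_num) hf hs h₁.2.2
  obtain rfl : t = X := ht.unique packs_X (by norm_num) (by norm_num)
  have trans : ∀ {a b e : ℕ} {p q : (ZMod 2)[X]}, a + b = e → f ∣ X ^ 2 ^ a - p →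
      f ∣ p ^ 2 ^ b - q → f ∣ X ^ 2 ^ e - q := by
    rintro a b _ p q rfl hp hq
    have h := dvd_add (hp.trans (sub_dvd_pow_sub_pow _ _ (2 ^ b))) hq
    rwa [sub_add_sub_cancel, ← pow_mul, ← pow_add] at h
  have cop : ∀ {a : ℕ} {p : (ZMod 2)[X]}, f ∣ X ^ 2 ^ a - p → IsCoprime f (p - X) →
      IsCoprime f (X ^ 2 ^ a - X) := by
    rintro a p ⟨c, hc⟩ h
    rw [← sub_add_sub_cancel _ p, hc]
    exact h.mul_add_left_right c
  have hfs' := trans (e := 500) (by norm_num) hfr hfs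
  have h200 := cop hfr (isCoprime_of_checkBezout (by norm_num) (by norm_num) hf hr h₂.1)
  have h500 := cop hfs' (isCoprime_of_checkBezout (by norm_num) (by norm_num) hf hs h₂.2)
  have h1000 := trans (e := 1000) (by norm_num) hfs' hft
  refine irreducible_of_rabin (by rw [hdeg]; norm_num) ?_ ?_
  · rw [Nat.card_zmod, hdeg]
    exact h1000
  · intro p hp hpd
    rw [Nat.card_zmod]
    rw [hdeg] at hpd ⊢
    have hp' : p = 2 ∨ p = 5 := by
      rw [show 1000 = 2 ^ 3 * 5 ^ 3 by norm_num, hp.dvd_mul] at hpd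
      exact hpd.imp (fun h => (Nat.prime_dvd_prime_iff_eq hp Nat.prime_two).1 (hp.dvd_of_dvd_pow h))
        (fun h => (Nat.prime_dvd_prime_iff_eq hp Nat.prime_five).1 (hp.dvd_of_dvd_pow h))
    rcases hp' with rfl | rfl
    · rw [show 1000 / 2 = 500 by norm_num]
      exact h500
    · rw [show 1000 / 5 = 200 by norm_num]
      exact h200

theorem Packs.not_isUnit {d N i : ℕ} {p : (ZMod 2)[X]} (h : Packs 1 d N p) (hi : i ≠ 0)
    (hN : N.testBit (16 * i) = true) : ¬ IsUnit p := by
  intro hu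
  have hc := h.coeff_eq (by norm_num) i
  rw [hN, coeff_eq_zero_of_natDegree_lt
    (by rw [natDegree_eq_zero_of_isUnit hu]; exact Nat.pos_of_ne_zero hi)] at hc
  simp at hc

theorem not_irreducible_of_packs_iter4 {f : (ZMod 2)[X]}
    (hf : Packs 1 10000 (packedComp 10000 packedIter3) f) : ¬ Irreducible f := by
  have h := checkFactor_iter4
  simp only [force_eq, Bool.and_eq_true] at h
  obtain ⟨g, hg⟩ := exists_packs_land (spread 14 leftFactorLit) 6000
  obtain ⟨q, hq⟩ := exists_packs_land (spread 14 rightFactorLit) 6000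
  have hgq := (hg.mul hq).land (D := 12000) (by norm_num) (by norm_num)
  rw [Nat.eq_of_beq_eq_true h.1] at hgq
  have hfac := hf.unique hgq (by norm_num) (by norm_num)
  intro hirr
  rcases hirr.isUnit_or_isUnit hfac with hu | hu
  · exact hg.not_isUnit (by norm_num) h.2.1 hu
  · exact hq.not_isUnit (by norm_num) h.2.2 hu

theorem deg_ten_example_iterates
    (f : Polynomial (ZMod 2))
    (hf : f = X ^ 10 + X ^ 9 + X ^ 6 + X ^ 5 + X ^ 4 + X ^ 3 + 1) :
    Irreducible f ∧ Irreducible (f.comp f) ∧ Irreducible (f.comp (f.comp f)) ∧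
      ¬ Irreducible (f.comp (f.comp (f.comp f))) := by
  have hdeg : f.natDegree = 10 := by
    rw [hf]
    compute_degree!
  have hcomp : ∀ {d e s : ℕ} {p : (ZMod 2)[X]}, d ≤ 1000 → 10 * d = e → Packs 1 d s p →
      Packs 1 e (packedComp e s) (f.comp p) := by
    rintro d _ s p hd rfl hs
    rw [hf]
    exact hs.packedComp hd
  have h1 : Packs 1 10 (packedComp 10 (2 ^ 16)) f := by
    simpa only [comp_X] using hcomp (by norm_num) (by norm_num) packs_X
  have h2 := hcomp (e := 100) (by norm_num) (by norm_num) h1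
  have h3 : Packs 1 1000 packedIter3 (f.comp (f.comp f)) :=
    hcomp (by norm_num) (by norm_num) h2
  have h4 : Packs 1 10000 (packedComp 10000 packedIter3) (f.comp (f.comp (f.comp f))) :=
    hcomp (by norm_num) (by norm_num) h3
  have hirr : Irreducible (f.comp (f.comp f)) :=
    irreducible_of_packs_iter3 h3 (by simp only [natDegree_comp, hdeg])
  have hirr2 : Irreducible (f.comp f) := by
    rw [← comp_assoc] at hirr
    exact hirr.of_polynomial_comp (by rw [hdeg]; norm_num)
  exact ⟨hirr2.of_polynomial_comp (by rw [hdeg]; norm_num), hirr2, hirr,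
    not_irreducible_of_packs_iter4 h4⟩
end
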